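/- arXiv:math/9610202 — 5 statements merged into one kernel-verified Lean document; each statement's English description precedes it below -/
import Mathlib

section
/- Let $0<m<n$, $s\ge 0$ integers, $k,h\in\mathbb{Z}$, and consider on $\mathbb{R}^s\times\mathbb{R}^m\times\mathbb{C}^{n-m}$ (coordinates $(\rho,\eta,w)$, Lebesgue measure) the kernel $K\{0,k,h,s\}(\rho,\eta,w,\epsilon)=\big(\epsilon+\sum_{i=1}^s|\rho_i|+\sum_{i=1}^m|\eta_i|+\sum_{i=1}^{n-m}|w_i|\big)^{-k}\big(\sqrt{\epsilon}+\sum_{i=1}^s\sqrt{|\rho_i|}+\sum_{i=1}^m\sqrt{|\eta_i|}+\sum_{i=1}^{n-m}|w_i|\big)^{-2h}$ and $\mathcal{I}_1\{0,k,h,s\}(\epsilon,\delta)=\int_{\mathbf{V}(\delta)}K\{0,k,h,s\}(\rho,\eta,w,\epsilon)\,d\lambda$. If $k\ge 2n-2m$ and $k+h-s\ge 2n-m$, then there exist $C>0$ and $\epsilon_0\in(0,1)$ such that for all $\epsilon\in(0,\epsilon_0)$ and all $\delta\in(0,1)$ one has $\mathcal{I}_1\{0,k,h,s\}(\epsilon,\delta)\le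 C\,\epsilon^{\,2n-m-k-h+s}\,(\log(1/\epsilon))^2$. -/
open MeasureTheory
lemma zp_anti {x y : ℝ} (hx : 0 < x) (hxy : x ≤ y) {e : ℤ} (he : e ≤ 0) : y ^ e ≤ x ^ e := by
  obtain ⟨j, hj⟩ := Int.eq_ofNat_of_zero_le (show 0 ≤ -e by lia)
  obtain rfl : e = -(j:ℤ) := by lia
  rw [zpow_neg, zpow_neg, zpow_natCast, zpow_natCast]
  gcongr

lemma zp_mono {x y : ℝ} (hx : 0 < x) (hxy : x ≤ y) {e : ℤ} (he : 0 ≤ e) : x ^ e ≤ y ^ e := by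
  obtain ⟨j, hj⟩ := Int.eq_ofNat_of_zero_le he
  obtain rfl : e = (j:ℤ) := by lia
  rw [zpow_natCast, zpow_natCast]
  gcongr

/-- pointwise bound -/
lemma ptwise (N d : ℕ) (k h : ℤ) (hk : 2 * (N:ℤ) ≤ k) (hkh : 2 * (N:ℤ) + d ≤ k + h)
    (M ε a A B : ℝ) (hε : 0 < ε) (ha : ε ≤ a) (hA : a ≤ A) (hB : 0 < B) (hM : 1 ≤ M)
    (hl : a ≤ B ^ 2) (hu : B ^ 2 ≤ M * A) :
    A ^ (-k) * B ^ (-(2 * h)) ≤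
      M ^ |h| * ε ^ (2 * (N:ℤ) + d - k - h) * (a ^ (-(d:ℤ)) * A ^ (-(2 * N:ℤ))) := by
  have ha0 : 0 < a := by linarith
  have hA0 : 0 < A := by linarith
  have hM0 : 0 < M := by linarith
  have hM1 : 1 ≤ M ^ |h| := one_le_zpow₀ hM (abs_nonneg h)
  have hB2 : B ^ (-(2 * h)) = (B ^ 2) ^ (-h) := by
    rw [← zpow_natCast, ← zpow_mul]; congr 1; push_cast; ring
  have key : A ^ (-k) * B ^ (-(2 * h)) ≤ M ^ |h| * (A ^ (-(2 * N:ℤ)) * a ^ (2 * (N:ℤ) - k - h)) := by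
    rw [hB2]
    rcases le_total 0 h with hh | hh
    · have h1 : (B ^ 2) ^ (-h) ≤ a ^ (-h) := zp_anti ha0 hl (by lia)
      have h2 : A ^ (2 * (N:ℤ) - k) ≤ a ^ (2 * (N:ℤ) - k) := zp_anti ha0 hA (by lia)
      have h3 : A ^ (-k) = A ^ (-(2 * N:ℤ)) * A ^ (2 * (N:ℤ) - k) := by
        rw [← zpow_add₀ hA0.ne']; congr 1; ring
      have h4 : a ^ (2 * (N:ℤ) - k - h) = a ^ (2 * (N:ℤ) - k) * a ^ (-h) := by
        rw [← zpow_add₀ ha0.ne']; congr 1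
      calc A ^ (-k) * (B ^ 2) ^ (-h) ≤ A ^ (-(2 * N:ℤ)) * a ^ (2 * (N:ℤ) - k) * a ^ (-h) := by
            rw [h3]; gcongr
        _ = 1 * (A ^ (-(2 * N:ℤ)) * a ^ (2 * (N:ℤ) - k - h)) := by rw [h4]; ring
        _ ≤ _ := by gcongr
    · have h1 : (B ^ 2) ^ (-h) ≤ M ^ |h| * A ^ (-h) := by
        rw [abs_of_nonpos hh, ← mul_zpow]
        exact zp_mono (by positivity) hu (by lia)
      have h2 : A ^ (2 * (N:ℤ) - k - h) ≤ a ^ (2 * (N:ℤ) - k - h) := zp_anti ha0 hA (by lia)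
      have h3 : A ^ (-k) * A ^ (-h) = A ^ (-(2 * N:ℤ)) * A ^ (2 * (N:ℤ) - k - h) := by
        rw [← zpow_add₀ hA0.ne', ← zpow_add₀ hA0.ne']; congr 1; ring
      calc A ^ (-k) * (B ^ 2) ^ (-h) ≤ A ^ (-k) * (M ^ |h| * A ^ (-h)) := by gcongr
        _ = M ^ |h| * (A ^ (-(2 * N:ℤ)) * A ^ (2 * (N:ℤ) - k - h)) := by rw [← h3]; ring
        _ ≤ _ := by gcongr
  refine key.trans ?_
  have h5 : a ^ (2 * (N:ℤ) - k - h) = a ^ (2 * (N:ℤ) + d - k - h) * a ^ (-(d:ℤ)) := by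
    rw [← zpow_add₀ ha0.ne']; congr 1; ring
  have h6 : a ^ (2 * (N:ℤ) + d - k - h) ≤ ε ^ (2 * (N:ℤ) + d - k - h) := zp_anti hε ha (by lia)
  calc _ ≤ M ^ |h| * (A ^ (-(2 * N:ℤ)) * (ε ^ (2 * (N:ℤ) + d - k - h) * a ^ (-(d:ℤ)))) := by
        rw [h5]; gcongr
    _ = _ := by ring


/-- radial cutoff kernel -/
noncomputable def radK (ε : ℝ) (D : ℕ) (t : ℝ) : ℝ :=
  Set.indicator (Set.Iic 1) (fun t => (ε + t) ^ (-(D:ℤ))) t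

lemma radK_nonneg (ε : ℝ) (hε : 0 < ε) (D : ℕ) (t : ℝ) (ht : 0 ≤ t) : 0 ≤ radK ε D t := by
  unfold radK
  apply Set.indicator_apply_nonneg
  intro _
  positivity

lemma radial {E : Type*} [NormedAddCommGroup E] [NormedSpace ℝ E] [MeasurableSpace E]
    [Nontrivial E] (μ : Measure E) [FiniteDimensional ℝ E] [BorelSpace E] [μ.IsAddHaarMeasure]
    (D : ℕ) (hD : Module.finrank ℝ E = D) :
    ∃ C > (0:ℝ), ∀ ε ∈ Set.Ioo (0:ℝ) (1/2), Integrable (fun x : E => radK ε D ‖x‖) μ ∧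
      ∫ x : E, radK ε D ‖x‖ ∂μ ≤ C * Real.log (1 / ε) := by
  have hDpos : 0 < D := hD ▸ Module.finrank_pos
  have hb : 0 ≤ μ.real (Metric.ball (0:E) 1) := measureReal_nonneg
  refine ⟨(D * μ.real (Metric.ball (0:E) 1)) * 2 + 1, by positivity, ?_⟩
  rintro ε ⟨hε, hε2⟩
  have heq : ∀ y : ℝ, y ^ (D - 1) • radK ε D y =
      Set.indicator (Set.Iic 1) (fun y => y ^ (D - 1) * (ε + y) ^ (-(D:ℤ))) y := by
    intro y
    unfold radK
    by_cases hy : y ∈ Set.Iic (1:ℝ) <;> simp [hy]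
  have hset : Set.Ioi (0:ℝ) ∩ Set.Iic 1 = Set.Ioc 0 1 := rfl
  have hcont : ContinuousOn (fun y : ℝ => y ^ (D - 1) * (ε + y) ^ (-(D:ℤ))) (Set.Icc 0 1) := by
    apply ContinuousOn.mul (by fun_prop)
    apply ContinuousOn.zpow₀ (by fun_prop)
    rintro a ⟨ha, _⟩
    left; positivity
  have hint : IntegrableOn (fun y : ℝ => y ^ (D - 1) * (ε + y) ^ (-(D:ℤ))) (Set.Ioc 0 1) :=
    (hcont.integrableOn_Icc).mono_set Set.Ioc_subset_Icc_self
  have hcont2 : ContinuousOn (fun y : ℝ => (ε + y)⁻¹) (Set.Icc 0 1) := by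
    apply ContinuousOn.inv₀ (by fun_prop)
    rintro a ⟨ha, _⟩
    positivity
  have hint2 : IntegrableOn (fun y : ℝ => (ε + y)⁻¹) (Set.Ioc 0 1) :=
    (hcont2.integrableOn_Icc).mono_set Set.Ioc_subset_Icc_self
  have hlog : 0 < Real.log (1/ε) := Real.log_pos (by rw [lt_div_iff₀ hε]; linarith)
  constructor
  · rw [integrable_fun_norm_addHaar μ (f := radK ε D), hD]
    simp only [heq]
    rw [IntegrableOn, integrable_indicator_iff measurableSet_Iic, IntegrableOn,
      Measure.restrict_restrict measurableSet_Iic, Set.inter_comm, hset]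
    exact hint
  · rw [integral_fun_norm_addHaar μ (radK ε D), hD]
    simp only [heq]
    rw [setIntegral_indicator measurableSet_Iic, hset]
    have h1 : ∫ y in Set.Ioc (0:ℝ) 1, y ^ (D - 1) * (ε + y) ^ (-(D:ℤ)) ≤
        ∫ y in Set.Ioc (0:ℝ) 1, (ε + y)⁻¹ := by
      refine setIntegral_mono_on hint hint2 measurableSet_Ioc ?_
      rintro y ⟨hy, _⟩
      have hp : 0 < ε + y := by positivity
      have : y ^ (D - 1) ≤ (ε + y) ^ (D - 1) := by
        gcongr; linarith
      calc y ^ (D - 1) * (ε + y) ^ (-(D:ℤ)) ≤ (ε + y) ^ (D - 1) * (ε + y) ^ (-(D:ℤ)) := by gcongr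
        _ = (ε + y)⁻¹ := by
          rw [← zpow_natCast, ← zpow_add₀ hp.ne', ← zpow_neg_one]; congr 1; lia
    have h2 : ∫ y in Set.Ioc (0:ℝ) 1, (ε + y)⁻¹ ≤ 2 * Real.log (1/ε) := by
      rw [← intervalIntegral.integral_of_le zero_le_one,
        intervalIntegral.integral_comp_add_left (fun x => x⁻¹) ε,
        integral_inv_of_pos (by linarith) (by linarith), add_zero]
      have : 2 * Real.log (1/ε) = Real.log ((1/ε)^2) := by rw [Real.log_pow]; norm_num
      rw [this]
      apply Real.log_le_log (by positivity)
      rw [div_pow, div_le_div_iff₀ hε (by positivity)]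
      nlinarith
    rw [nsmul_eq_mul, smul_eq_mul]
    calc _ ≤ (D:ℝ) * (μ.real (Metric.ball (0:E) 1) * (2 * Real.log (1/ε))) := by
          gcongr; exact h1.trans h2
      _ ≤ _ := by nlinarith

set_option maxHeartbeats 2000000 in
lemma I1_aux (N m s : ℕ) (hm : 0 < m) (hN : 0 < N) (k h : ℤ)
    (hk : 2 * (N : ℤ) ≤ k)
    (hkh : 2 * (N : ℤ) + (s + m : ℕ) ≤ k + h) :
    ∃ C > (0 : ℝ), ∃ ε₀ ∈ Set.Ioo (0 : ℝ) 1,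
      ∀ ε ∈ Set.Ioo (0 : ℝ) ε₀, ∀ δ ∈ Set.Ioo (0 : ℝ) 1,
        (∫ x : (Fin s → ℝ) × (Fin m → ℝ) × (Fin N → ℂ) in
            {p : (Fin s → ℝ) × (Fin m → ℝ) × (Fin N → ℂ) |
              (∑ i, |p.1 i|) + (∑ i, |p.2.1 i|) + (∑ i, ‖p.2.2 i‖ ^ 2) < δ ^ 2},
          (ε + (∑ i, |x.1 i|) + (∑ i, |x.2.1 i|) + ∑ i, ‖x.2.2 i‖) ^ (-k) *
            (Real.sqrt ε + (∑ i, Real.sqrt |x.1 i|) + (∑ i, Real.sqrt |x.2.1 i|) +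
              ∑ i, ‖x.2.2 i‖) ^ (-(2 * h)))
        ≤ C * ε ^ (2 * (N : ℤ) + (s + m : ℕ) - k - h) * Real.log (1 / ε) ^ 2 := by
  have : Nonempty (Fin m) := ⟨⟨0, hm⟩⟩
  have : Nonempty (Fin N) := ⟨⟨0, hN⟩⟩
  have : (volume : Measure ((Fin s → ℝ) × (Fin m → ℝ))).IsAddHaarMeasure :=
    Measure.prod.instIsAddHaarMeasure volume volume
  obtain ⟨C1, hC1, H1⟩ := radial (volume : Measure ((Fin s → ℝ) × (Fin m → ℝ))) (s + m) (by simp)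
  obtain ⟨C2, hC2, H2⟩ := radial (volume : Measure (Fin N → ℂ)) (2 * N) (by
    rw [Module.finrank_pi_fintype]; simp [mul_comm])
  set M : ℝ := (1 + s + m + N) ^ 2 with hM
  have hM1 : 1 ≤ M := by
    have : (1:ℝ) ≤ 1 + s + m + N := by
      have : (0:ℝ) ≤ s + m + N := by positivity
      linarith
    exact one_le_pow₀ this
  refine ⟨M ^ |h| * (C1 * C2), by positivity, 1/2, by norm_num, ?_⟩
  intro ε hε δ hδ
  obtain ⟨I1, J1⟩ := H1 ε hε
  obtain ⟨I2, J2⟩ := H2 ε hε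
  obtain ⟨hε, hε2⟩ := hε
  obtain ⟨hδ, hδ1⟩ := hδ
  set e := 2 * (N : ℤ) + (s + m : ℕ) - k - h with he
  set g : (Fin s → ℝ) × (Fin m → ℝ) × (Fin N → ℂ) → ℝ := fun x =>
    M ^ |h| * ε ^ e * (radK ε (s + m) ‖(x.1, x.2.1)‖ * radK ε (2 * N) ‖x.2.2‖) with hg
  have hlog : 0 < Real.log (1/ε) := Real.log_pos (by rw [lt_div_iff₀ hε]; linarith)
  have hpres := volume_preserving_prodAssoc (α₁ := Fin s → ℝ) (β₁ := Fin m → ℝ) (γ₁ := Fin N → ℂ)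
  have hprod := (I1.mul_prod I2).const_mul (M ^ |h| * ε ^ e)
  have hgi : Integrable g := by
    rw [← hpres.integrable_comp_emb MeasurableEquiv.prodAssoc.measurableEmbedding]
    exact hprod
  have hg0 : ∀ x, 0 ≤ g x := fun x => by
    have := radK_nonneg ε hε (s + m) ‖(x.1, x.2.1)‖ (norm_nonneg _)
    have := radK_nonneg ε hε (2 * N) ‖x.2.2‖ (norm_nonneg _)
    simp only [hg]
    positivity
  have hgint : ∫ x, g x ≤ M ^ |h| * (C1 * C2) * ε ^ e * Real.log (1 / ε) ^ 2 := by
    rw [← hpres.integral_comp MeasurableEquiv.prodAssoc.measurableEmbedding]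
    have : ∫ x : ((Fin s → ℝ) × (Fin m → ℝ)) × (Fin N → ℂ), g (MeasurableEquiv.prodAssoc x) =
        M ^ |h| * ε ^ e * ((∫ y : (Fin s → ℝ) × (Fin m → ℝ), radK ε (s + m) ‖y‖) *
          ∫ w : Fin N → ℂ, radK ε (2 * N) ‖w‖) := by
      rw [← integral_prod_mul, ← integral_const_mul]
      rfl
    rw [this]
    have p2 : 0 ≤ ∫ w : Fin N → ℂ, radK ε (2 * N) ‖w‖ :=
      integral_nonneg fun w => radK_nonneg ε hε _ _ (norm_nonneg _)
    calc _ ≤ M ^ |h| * ε ^ e * ((C1 * Real.log (1/ε)) * (C2 * Real.log (1/ε))) := by gcongr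
      _ = _ := by ring
  refine le_trans ?_ hgint
  refine le_trans ?_ (setIntegral_le_integral (s := {p : (Fin s → ℝ) × (Fin m → ℝ) × (Fin N → ℂ) |
    (∑ i, |p.1 i|) + (∑ i, |p.2.1 i|) + (∑ i, ‖p.2.2 i‖ ^ 2) < δ ^ 2}) hgi
    (Filter.Eventually.of_forall hg0))
  refine integral_mono_of_nonneg (Filter.Eventually.of_forall fun x => ?_) hgi.integrableOn ?_
  · simp only [Pi.zero_apply]
    positivity
  refine ae_restrict_of_forall_mem ?_ ?_
  · apply IsOpen.measurableSet
    exact isOpen_lt (by fun_prop) (by fun_prop)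
  rintro ⟨ρ, η, w⟩ hx
  simp only [Set.mem_ofPred_eq] at hx
  have hδ2 : δ ^ 2 < 1 := by nlinarith
  have q1 : 0 ≤ ∑ i, |ρ i| := by positivity
  have q2 : 0 ≤ ∑ i, |η i| := by positivity
  have q3 : 0 ≤ ∑ i, ‖w i‖ ^ 2 := by positivity
  have q4 : 0 ≤ ∑ i, ‖w i‖ := by positivity
  have r1 : ∀ i, |ρ i| ≤ ∑ i, |ρ i| := fun i =>
    Finset.single_le_sum (f := fun i => |ρ i|) (fun j _ => abs_nonneg _) (Finset.mem_univ i)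
  have r2 : ∀ i, |η i| ≤ ∑ i, |η i| := fun i =>
    Finset.single_le_sum (f := fun i => |η i|) (fun j _ => abs_nonneg _) (Finset.mem_univ i)
  have r3 : ∀ i, ‖w i‖ ^ 2 ≤ ∑ i, ‖w i‖ ^ 2 := fun i =>
    Finset.single_le_sum (f := fun i => ‖w i‖ ^ 2) (fun j _ => by positivity) (Finset.mem_univ i)
  have r4 : ∀ i, ‖w i‖ ≤ ∑ i, ‖w i‖ := fun i =>
    Finset.single_le_sum (f := fun i => ‖w i‖) (fun j _ => by positivity) (Finset.mem_univ i)
  have w1 : ∀ i, ‖w i‖ ≤ 1 := fun i => by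
    have := r3 i
    have := norm_nonneg (w i)
    nlinarith
  have nw1 : ‖w‖ ≤ 1 := (pi_norm_le_iff_of_nonneg zero_le_one).2 w1
  have nw : ‖w‖ ≤ ∑ i, ‖w i‖ := (pi_norm_le_iff_of_nonneg q4).2 r4
  have ny : ‖(ρ, η)‖ ≤ (∑ i, |ρ i|) + ∑ i, |η i| := by
    refine norm_prod_le_iff.2 ⟨?_, ?_⟩
    · exact (pi_norm_le_iff_of_nonneg (by positivity)).2 fun i => by
        have := r1 i
        rw [Real.norm_eq_abs]; linarith
    · exact (pi_norm_le_iff_of_nonneg (by positivity)).2 fun i => by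
        have := r2 i
        rw [Real.norm_eq_abs]; linarith
  have ny1 : ‖(ρ, η)‖ ≤ 1 := by linarith
  have t1 : 0 ≤ ∑ i, √|ρ i| := by positivity
  have t2 : 0 ≤ ∑ i, √|η i| := by positivity
  have hsε : 0 < √ε := Real.sqrt_pos.2 hε
  set a := ε + (∑ i, |ρ i|) + ∑ i, |η i| with hadef
  set A := a + ∑ i, ‖w i‖ with hAdef
  set B := √ε + (∑ i, √|ρ i|) + (∑ i, √|η i|) + ∑ i, ‖w i‖ with hBdef
  have haε : ε ≤ a := by linarith
  have ha0 : 0 < a := by linarith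
  have hA0 : 0 < A := by linarith
  have hB0 : 0 < B := by linarith
  have hl : a ≤ B ^ 2 := by
    have u1 : ∑ i, |ρ i| ≤ (∑ i, √|ρ i|) ^ 2 := by
      refine le_trans (le_of_eq ?_) (Finset.sum_sq_le_sq_sum_of_nonneg fun i _ => Real.sqrt_nonneg _)
      simp
    have u2 : ∑ i, |η i| ≤ (∑ i, √|η i|) ^ 2 := by
      refine le_trans (le_of_eq ?_) (Finset.sum_sq_le_sq_sum_of_nonneg fun i _ => Real.sqrt_nonneg _)
      simp
    have u3 : ε = √ε ^ 2 := (Real.sq_sqrt hε.le).symm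
    have : 0 ≤ B ^ 2 - (√ε ^ 2 + (∑ i, √|ρ i|) ^ 2 + (∑ i, √|η i|) ^ 2) := by
      have : B ^ 2 - (√ε ^ 2 + (∑ i, √|ρ i|) ^ 2 + (∑ i, √|η i|) ^ 2) =
        2 * √ε * (∑ i, √|ρ i|) + 2 * √ε * (∑ i, √|η i|) + 2 * (∑ i, √|ρ i|) * (∑ i, √|η i|)
        + (∑ i, ‖w i‖) ^ 2 + 2 * (∑ i, ‖w i‖) * (√ε + (∑ i, √|ρ i|) + (∑ i, √|η i|)) := by
          rw [hBdef]; ring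
      rw [this]; positivity
    linarith
  have hu : B ^ 2 ≤ M * A := by
    have v0 : √ε ≤ √A := Real.sqrt_le_sqrt (by linarith)
    have v1 : ∑ i, √|ρ i| ≤ s * √A := by
      have := Finset.sum_le_card_nsmul Finset.univ (fun i => √|ρ i|) √A
        (fun i _ => Real.sqrt_le_sqrt (by have := r1 i; linarith))
      simpa using this
    have v2 : ∑ i, √|η i| ≤ m * √A := by
      have := Finset.sum_le_card_nsmul Finset.univ (fun i => √|η i|) √A
        (fun i _ => Real.sqrt_le_sqrt (by have := r2 i; linarith))
      simpa using this
    have v3 : ∑ i, ‖w i‖ ≤ N * √A := by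
      have := Finset.sum_le_card_nsmul Finset.univ (fun i => ‖w i‖) √A
        (fun i _ => Real.le_sqrt_of_sq_le (by
          have := r4 i
          have := w1 i
          have := norm_nonneg (w i)
          nlinarith))
      simpa using this
    have v4 : B ≤ (1 + s + m + N) * √A := by
      rw [hBdef]; linarith
    calc B ^ 2 ≤ ((1 + s + m + N) * √A) ^ 2 := by gcongr
      _ = M * A := by rw [mul_pow, Real.sq_sqrt hA0.le]
  have key := ptwise N (s + m) k h hk hkh M ε a A B hε haε (by linarith) hB0 hM1 hl hu
  refine key.trans ?_
  simp only [hg, radK]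
  rw [Set.indicator_of_mem (show ‖(ρ, η)‖ ∈ Set.Iic (1:ℝ) from ny1),
    Set.indicator_of_mem (show ‖w‖ ∈ Set.Iic (1:ℝ) from nw1)]
  have f1 : a ^ (-((s + m : ℕ) : ℤ)) ≤ (ε + ‖(ρ, η)‖) ^ (-((s + m : ℕ) : ℤ)) :=
    zp_anti (by positivity) (by linarith) (by lia)
  have f2 : A ^ (-(2 * N : ℤ)) ≤ (ε + ‖w‖) ^ (-((2 * N : ℕ) : ℤ)) := by
    push_cast
    exact zp_anti (by positivity) (by linarith) (by lia)
  gcongr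


/-- Lemma (Integral estimates), case `𝓘₁{0,k,h,s}` with `k ≥ 2n-2m` and `k+h-s ≥ 2n-m`:
the integral of the kernel `K{0,k,h,s}` over `V(δ)` is `O(ε^(2n-m-k-h+s) (log ε)²)`. -/
theorem I1_estimate_log_sq (n m s : ℕ) (hm : 0 < m) (hmn : m < n) (k h : ℤ)
    (hk : 2 * (n : ℤ) - 2 * (m : ℤ) ≤ k)
    (hkh : 2 * (n : ℤ) - (m : ℤ) ≤ k + h - (s : ℤ)) :
    ∃ C > (0 : ℝ), ∃ ε₀ ∈ Set.Ioo (0 : ℝ) 1,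
      ∀ ε ∈ Set.Ioo (0 : ℝ) ε₀, ∀ δ ∈ Set.Ioo (0 : ℝ) 1,
        (∫ x : (Fin s → ℝ) × (Fin m → ℝ) × (Fin (n - m) → ℂ) in
            {p : (Fin s → ℝ) × (Fin m → ℝ) × (Fin (n - m) → ℂ) |
              (∑ i, |p.1 i|) + (∑ i, |p.2.1 i|) + (∑ i, ‖p.2.2 i‖ ^ 2) < δ ^ 2},
          (ε + (∑ i, |x.1 i|) + (∑ i, |x.2.1 i|) + ∑ i, ‖x.2.2 i‖) ^ (-k) *
            (Real.sqrt ε + (∑ i, Real.sqrt |x.1 i|) + (∑ i, Real.sqrt |x.2.1 i|) +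
              ∑ i, ‖x.2.2 i‖) ^ (-(2 * h)))
        ≤ C * ε ^ (2 * (n : ℤ) - (m : ℤ) - k - h + (s : ℤ)) * Real.log (1 / ε) ^ 2 := by
  obtain ⟨N, rfl⟩ := Nat.exists_eq_add_of_lt hmn
  have hN : m + N + 1 - m = N + 1 := by lia
  have := I1_aux (m + N + 1 - m) m s hm (by lia) k h (by rw [hN]; push_cast at *; lia)
    (by rw [hN]; push_cast at *; lia)
  convert this using 16
  rw [hN]; push_cast; ring
end

section
/- Let $0<m<n$, $s\ge 0$ integers, $k,h\in\mathbb{Z}$, and consider on $\mathbb{R}^s\times\mathbb{R}^m\times\mathbb{C}^{n-m}$ (coordinates $(\rho,\eta,w)$, Lebesgue measure) the kernel $K\{0,k,h,s\}(\rho,\eta,w,\epsilon)=\big(\epsilon+\sum_{i=1}^s|\rho_i|+\sum_{i=1}^m|\eta_i|+\sum_{i=1}^{n-m}|w_i|\big)^{-k}\big(\sqrt{\epsilon}+\sum_{i=1}^s\sqrt{|\rho_i|}+\sum_{i=1}^m\sqrt{|\eta_i|}+\sum_{i=1}^{n-m}|w_i|\big)^{-2h}$ and $\mathcal{I}_1\{0,k,h,s\}(\epsilon,\delta)=\int_{\mathbf{V}(\delta)}K\{0,k,h,s\}(\rho,\eta,w,\epsilon)\,d\lambda$.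 If $k\ge 2n-2m$ and $k+h-s\le 2n-m-1$, then there exists $C>0$ such that for all $\epsilon\in(0,1)$ and all $\delta\in(0,1)$ one has $\mathcal{I}_1\{0,k,h,s\}(\epsilon,\delta)\le C\,\delta$. -/
open MeasureTheory

lemma aux_core (A B t M : ℝ) (N d j l : ℕ) (hd : 1 ≤ d) (k h : ℤ)
    (hk : k = 2 * N + j) (hh : h = d - 1 - j - l)
    (ht : 0 < t) (hB : 0 < B) (htA : t ≤ A) (htB : t ≤ B ^ 2) (hBA : B ^ 2 ≤ M * A)
    (hBM : B ^ 2 ≤ M) :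
    A ^ (-k) * B ^ (-(2 * h)) ≤
      M ^ (j + l) * (A ^ (-(2 * (N : ℝ) - 1 / 2)) * t ^ (-((d : ℝ) - 1 / 2))) := by
  have hA : 0 < A := ht.trans_le htA
  have hB2 : 0 < B ^ 2 := by positivity
  have hM : 0 < M := hB2.trans_le hBM
  obtain ⟨e, rfl⟩ : ∃ e, d = e + 1 := ⟨d - 1, by omega⟩
  have e1 : A ^ (-k) * B ^ (-(2 * h)) =
      (A ^ (2 * N))⁻¹ * ((B ^ 2) ^ e)⁻¹ * ((B ^ 2 / A) ^ j * (B ^ 2) ^ l) := by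
    subst hk hh
    have h1 : -(2 * (N : ℤ) + j) = -((2 * N : ℕ) : ℤ) + -(j : ℤ) := by push_cast; ring
    have h2 : -(2 * (((e + 1 : ℕ) : ℤ) - 1 - j - l)) =
        -((2 * e : ℕ) : ℤ) + ((2 * j : ℕ) : ℤ) + ((2 * l : ℕ) : ℤ) := by push_cast; ring
    rw [h1, h2, zpow_add₀ hA.ne', zpow_add₀ hB.ne', zpow_add₀ hB.ne']
    simp only [zpow_neg, zpow_natCast]
    rw [div_pow, ← pow_mul, ← pow_mul, ← pow_mul]
    field_simp
  rw [e1]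
  have h3 : (B ^ 2 / A) ^ j * (B ^ 2) ^ l ≤ M ^ (j + l) := by
    rw [pow_add]
    have : B ^ 2 / A ≤ M := by rwa [div_le_iff₀ hA]
    gcongr
  have h4 : ((B ^ 2) ^ e)⁻¹ ≤ (t ^ e)⁻¹ := by gcongr
  have h5 : (A ^ (2 * N))⁻¹ ≤ A ^ (-(2 * (N : ℝ) - 1 / 2)) * t ^ (-(1 / 2) : ℝ) := by
    have : (A ^ (2 * N))⁻¹ = A ^ (-(2 * (N : ℝ) - 1 / 2)) * A ^ (-(1 / 2) : ℝ) := by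
      rw [← Real.rpow_add hA, ← Real.rpow_natCast, ← Real.rpow_neg hA.le]
      congr 1; push_cast; ring
    rw [this]
    have := Real.rpow_le_rpow_of_nonpos (z := -(1/2)) ht htA (by norm_num)
    gcongr
  have h6 : t ^ (-(((e + 1 : ℕ) : ℝ) - 1 / 2)) = t ^ (-(1 / 2) : ℝ) * (t ^ e)⁻¹ := by
    rw [← Real.rpow_natCast, ← Real.rpow_neg ht.le, ← Real.rpow_add ht]
    congr 1; push_cast; ring
  rw [h6, mul_comm (M ^ (j + l)), ← mul_assoc (A ^ (-(2 * (N : ℝ) - 1 / 2)))]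
  gcongr

lemma aux_prod {ι E : Type*} [Fintype ι] [NormedAddCommGroup E] (v : ι → E) (A c : ℝ) (hc : c ≤ 0)
    (hv : ∀ i, v i ≠ 0) (hA : ∀ i, ‖v i‖ ≤ A) :
    (A ^ c) ^ (Fintype.card ι) ≤ ∏ i, ‖v i‖ ^ c := by
  rw [Fintype.card, ← Finset.prod_const]
  refine Finset.prod_le_prod (fun i _ => ?_) fun i _ => ?_
  · exact Real.rpow_nonneg ((norm_nonneg _).trans (hA i)) _
  · exact Real.rpow_le_rpow_of_nonpos (norm_pos_iff.2 (hv i)) (hA i) hc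

lemma aux_phi (c R : ℝ) (hc : -1 < c) (hR : 0 < R) :
    Integrable ((Metric.ball (0 : ℝ) R).indicator (fun x => ‖x‖ ^ c)) ∧
    ∫ x, (Metric.ball (0 : ℝ) R).indicator (fun x => ‖x‖ ^ c) x = 2 * (R ^ (c + 1) / (c + 1)) := by
  constructor
  · rw [integrable_indicator_iff Metric.isOpen_ball.measurableSet]
    have := (integrableOn_fun_norm_addHaar (E := ℝ) volume (f := fun y => y ^ c) (r := R)).2
    apply this
    simpa using (intervalIntegral.integrableOn_Ioo_rpow_iff hR).2 hc
  · have : (Metric.ball (0 : ℝ) R).indicator (fun x => ‖x‖ ^ c) =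
        fun x => (Set.Iio R).indicator (fun y => y ^ c) |x| := by
      ext x; simp [Set.indicator]
    rw [this, integral_comp_abs (f := (Set.Iio R).indicator (fun y => y ^ c)),
      setIntegral_indicator measurableSet_Iio, Set.Ioi_inter_Iio, ← integral_Ioc_eq_integral_Ioo,
      ← intervalIntegral.integral_of_le hR.le, integral_rpow (Or.inl hc),
      Real.zero_rpow (by linarith), sub_zero]

lemma aux_psi (c : ℝ) (hc : -2 < c) :
    Integrable ((Metric.ball (0 : ℂ) 1).indicator (fun x => ‖x‖ ^ c)) := by
  rw [integrable_indicator_iff Metric.isOpen_ball.measurableSet]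
  have := (integrableOn_fun_norm_addHaar (E := ℂ) volume (f := fun y => y ^ c) (r := 1)).2
  apply this
  have h2 : IntegrableOn (fun y : ℝ => y ^ (c + 1)) (Set.Ioo 0 1) :=
    (intervalIntegral.integrableOn_Ioo_rpow_iff one_pos).2 (by linarith)
  refine h2.congr_fun (fun y hy => ?_) measurableSet_Ioo
  simp [Complex.finrank_real_complex, Real.rpow_add hy.1, mul_comm]

lemma aux_ae (s m N : ℕ) : ∀ᵐ x : (Fin s → ℝ) × (Fin m → ℝ) × (Fin N → ℂ),
    (∀ i, x.1 i ≠ 0) ∧ (∀ i, x.2.1 i ≠ 0) ∧ (∀ i, x.2.2 i ≠ 0) := by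
  have h1 : ∀ᵐ y : Fin s → ℝ, ∀ i, y i ≠ 0 := ae_all_iff.2 fun i => Measure.ae_eval_ne _ i 0
  have h2 : ∀ᵐ y : Fin m → ℝ, ∀ i, y i ≠ 0 := ae_all_iff.2 fun i => Measure.ae_eval_ne _ i 0
  have h3 : ∀ᵐ y : Fin N → ℂ, ∀ i, y i ≠ 0 := ae_all_iff.2 fun i => Measure.ae_eval_ne _ i 0
  have q1 := Measure.quasiMeasurePreserving_fst
    (μ := (volume : Measure (Fin s → ℝ))) (ν := (volume : Measure ((Fin m → ℝ) × (Fin N → ℂ))))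
  have q2 := Measure.quasiMeasurePreserving_snd
    (μ := (volume : Measure (Fin s → ℝ))) (ν := (volume : Measure ((Fin m → ℝ) × (Fin N → ℂ))))
  have q3 := Measure.quasiMeasurePreserving_fst
    (μ := (volume : Measure (Fin m → ℝ))) (ν := (volume : Measure (Fin N → ℂ)))
  have q4 := Measure.quasiMeasurePreserving_snd
    (μ := (volume : Measure (Fin m → ℝ))) (ν := (volume : Measure (Fin N → ℂ)))
  exact (q1.ae h1).and ((q2.ae (q3.ae h2)).and (q2.ae (q4.ae h3)))

lemma aux_sqrt_sum {ι : Type*} [Fintype ι] (f : ι → ℝ) :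
    ∑ i, |f i| ≤ (∑ i, Real.sqrt |f i|) ^ 2 := by
  have := Finset.sum_sq_le_sq_sum_of_nonneg (s := Finset.univ) (f := fun i => Real.sqrt |f i|)
    (fun i _ => Real.sqrt_nonneg _)
  simpa [Real.sq_sqrt] using this

lemma aux_sum_le {ι : Type*} [Fintype ι] (f : ι → ℝ) (Q : ℝ) (h : ∀ i, f i ≤ Q) :
    ∑ i, f i ≤ Fintype.card ι * Q := by
  have := Finset.sum_le_card_nsmul Finset.univ f Q (fun i _ => h i)
  simpa using this

lemma aux_point (s m N : ℕ) (hm : 0 < m) (hN : 0 < N) (k h : ℤ) (j l : ℕ)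
    (hk : k = 2 * N + j) (hh : h = (s + m : ℕ) - 1 - j - l) (ε δ : ℝ)
    (hε : 0 < ε) (hε1 : ε < 1) (hδ : 0 < δ) (hδ1 : δ < 1)
    (a : Fin s → ℝ) (b : Fin m → ℝ) (w : Fin N → ℂ)
    (hS : (∑ i, |a i|) + (∑ i, |b i|) + (∑ i, ‖w i‖ ^ 2) < δ ^ 2)
    (ha : ∀ i, a i ≠ 0) (hb : ∀ i, b i ≠ 0) (hw : ∀ i, w i ≠ 0) :
    (ε + (∑ i, |a i|) + (∑ i, |b i|) + ∑ i, ‖w i‖) ^ (-k) *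
            (Real.sqrt ε + (∑ i, Real.sqrt |a i|) + (∑ i, Real.sqrt |b i|) +
              ∑ i, ‖w i‖) ^ (-(2 * h)) ≤
    ((1 + s + m + N : ℝ) ^ 2) ^ (j + l) *
      ((∏ i, (Metric.ball (0 : ℝ) (δ ^ 2)).indicator
          (fun x => ‖x‖ ^ (-(((s + m : ℕ) : ℝ) - 1 / 2) / (s + m : ℕ))) (a i)) *
      ((∏ i, (Metric.ball (0 : ℝ) (δ ^ 2)).indicator
          (fun x => ‖x‖ ^ (-(((s + m : ℕ) : ℝ) - 1 / 2) / (s + m : ℕ))) (b i)) *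
       ∏ i, (Metric.ball (0 : ℂ) 1).indicator
          (fun x => ‖x‖ ^ (-(2 * (N : ℝ) - 1 / 2) / N)) (w i))) := by
  have sa : ∀ i, |a i| ≤ ∑ i, |a i| := fun i =>
    Finset.single_le_sum (f := fun i => |a i|) (fun _ _ => abs_nonneg _) (Finset.mem_univ i)
  have sb : ∀ i, |b i| ≤ ∑ i, |b i| := fun i =>
    Finset.single_le_sum (f := fun i => |b i|) (fun _ _ => abs_nonneg _) (Finset.mem_univ i)
  have sw : ∀ i, ‖w i‖ ≤ ∑ i, ‖w i‖ := fun i =>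
    Finset.single_le_sum (f := fun i => ‖w i‖) (fun _ _ => norm_nonneg _) (Finset.mem_univ i)
  have sw2 : ∀ i, ‖w i‖ ^ 2 ≤ ∑ i, ‖w i‖ ^ 2 := fun i =>
    Finset.single_le_sum (f := fun i => ‖w i‖ ^ 2) (fun _ _ => sq_nonneg _) (Finset.mem_univ i)
  have na : 0 ≤ ∑ i, |a i| := Finset.sum_nonneg fun _ _ => abs_nonneg _
  have nb : 0 ≤ ∑ i, |b i| := Finset.sum_nonneg fun _ _ => abs_nonneg _
  have nw : 0 ≤ ∑ i, ‖w i‖ := Finset.sum_nonneg fun _ _ => norm_nonneg _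
  have nw2 : 0 ≤ ∑ i, ‖w i‖ ^ 2 := Finset.sum_nonneg fun _ _ => sq_nonneg _
  have nqa : 0 ≤ ∑ i, Real.sqrt |a i| := Finset.sum_nonneg fun _ _ => Real.sqrt_nonneg _
  have nqb : 0 ≤ ∑ i, Real.sqrt |b i| := Finset.sum_nonneg fun _ _ => Real.sqrt_nonneg _
  have hδ2 : δ ^ 2 < 1 := by nlinarith
  have qa := aux_sqrt_sum a
  have qb := aux_sqrt_sum b
  have hwlt : ∀ i, ‖w i‖ < 1 := fun i => by
    have := sw2 i
    nlinarith [norm_nonneg (w i)]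
  have sε : 0 < Real.sqrt ε := Real.sqrt_pos.2 hε
  set A := ε + (∑ i, |a i|) + (∑ i, |b i|) + ∑ i, ‖w i‖ with hAdef
  set B := Real.sqrt ε + (∑ i, Real.sqrt |a i|) + (∑ i, Real.sqrt |b i|) + ∑ i, ‖w i‖ with hBdef
  set t := (∑ i, |a i|) + (∑ i, |b i|) with htdef
  have ht : 0 < t := by
    have h1 := abs_pos.2 (hb ⟨0, hm⟩)
    have h2 := sb ⟨0, hm⟩
    linarith
  have hB : 0 < B := by linarith
  have htA : t ≤ A := by linarith
  have hA : 0 < A := by linarith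
  have htB : t ≤ B ^ 2 := by
    have : (∑ i, Real.sqrt |a i|) + (∑ i, Real.sqrt |b i|) ≤ B := by linarith
    nlinarith
  have hbd : ∀ Q : ℝ, Real.sqrt ε ≤ Q → (∀ i, Real.sqrt |a i| ≤ Q) → (∀ i, Real.sqrt |b i| ≤ Q) →
      (∀ i, ‖w i‖ ≤ Q) → B ≤ (1 + s + m + N : ℝ) * Q := by
    intro Q h0 h1 h2 h3
    have h1' := aux_sum_le _ Q h1
    have h2' := aux_sum_le _ Q h2
    have h3' := aux_sum_le _ Q h3
    simp only [Fintype.card_fin] at h1' h2' h3'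
    rw [hBdef]
    linarith
  have hBA : B ^ 2 ≤ (1 + s + m + N : ℝ) ^ 2 * A := by
    have := hbd (Real.sqrt A) (Real.sqrt_le_sqrt (by linarith))
      (fun i => Real.sqrt_le_sqrt (by linarith [sa i]))
      (fun i => Real.sqrt_le_sqrt (by linarith [sb i]))
      (fun i => by
        apply Real.le_sqrt_of_sq_le
        have := sw i
        have := hwlt i
        nlinarith [norm_nonneg (w i)])
    calc B ^ 2 ≤ ((1 + s + m + N : ℝ) * Real.sqrt A) ^ 2 := by gcongr
      _ = _ := by rw [mul_pow, Real.sq_sqrt hA.le]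
  have hBM : B ^ 2 ≤ (1 + s + m + N : ℝ) ^ 2 := by
    have := hbd 1 (Real.sqrt_le_one.2 hε1.le)
      (fun i => Real.sqrt_le_one.2 (by linarith [sa i]))
      (fun i => Real.sqrt_le_one.2 (by linarith [sb i]))
      (fun i => (hwlt i).le)
    rw [mul_one] at this
    gcongr
  have hd : 1 ≤ s + m := by omega
  have key := aux_core A B t ((1 + s + m + N : ℝ) ^ 2) N (s + m) j l hd k h hk hh ht hB htA htB hBA hBM
  refine key.trans ?_
  have hdR : (1 : ℝ) ≤ ((s + m : ℕ) : ℝ) := by exact_mod_cast hd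
  have hNR : (1 : ℝ) ≤ (N : ℝ) := by exact_mod_cast hN
  have ea : ∀ i, (Metric.ball (0 : ℝ) (δ ^ 2)).indicator
          (fun x => ‖x‖ ^ (-(((s + m : ℕ) : ℝ) - 1 / 2) / (s + m : ℕ))) (a i) =
          ‖a i‖ ^ (-(((s + m : ℕ) : ℝ) - 1 / 2) / (s + m : ℕ)) := fun i =>
    Set.indicator_of_mem (by simpa using (by linarith [sa i] : |a i| < δ ^ 2)) _
  have eb : ∀ i, (Metric.ball (0 : ℝ) (δ ^ 2)).indicator
          (fun x => ‖x‖ ^ (-(((s + m : ℕ) : ℝ) - 1 / 2) / (s + m : ℕ))) (b i) =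
          ‖b i‖ ^ (-(((s + m : ℕ) : ℝ) - 1 / 2) / (s + m : ℕ)) := fun i =>
    Set.indicator_of_mem (by simpa using (by linarith [sb i] : |b i| < δ ^ 2)) _
  have ew : ∀ i, (Metric.ball (0 : ℂ) 1).indicator
          (fun x => ‖x‖ ^ (-(2 * (N : ℝ) - 1 / 2) / N)) (w i) =
          ‖w i‖ ^ (-(2 * (N : ℝ) - 1 / 2) / N) := fun i =>
    Set.indicator_of_mem (by simpa using hwlt i) _
  simp only [ea, eb, ew]
  have c1 : -(((s + m : ℕ) : ℝ) - 1 / 2) / (s + m : ℕ) ≤ 0 :=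
    div_nonpos_of_nonpos_of_nonneg (by linarith) (by linarith)
  have c2 : -(2 * (N : ℝ) - 1 / 2) / N ≤ 0 :=
    div_nonpos_of_nonpos_of_nonneg (by linarith) (by linarith)
  have pa := aux_prod a t _ c1 ha (fun i => by rw [Real.norm_eq_abs]; linarith [sa i])
  have pb := aux_prod b t _ c1 hb (fun i => by rw [Real.norm_eq_abs]; linarith [sb i])
  have pw := aux_prod w A _ c2 hw (fun i => by linarith [sw i])
  rw [Fintype.card_fin] at pa pb pw
  have et : t ^ (-(((s + m : ℕ) : ℝ) - 1 / 2)) =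
      (t ^ (-(((s + m : ℕ) : ℝ) - 1 / 2) / (s + m : ℕ))) ^ s *
      (t ^ (-(((s + m : ℕ) : ℝ) - 1 / 2) / (s + m : ℕ))) ^ m := by
    rw [← pow_add, ← Real.rpow_natCast (_ ^ _), ← Real.rpow_mul ht.le, div_mul_cancel₀]
    linarith
  have eA : A ^ (-(2 * (N : ℝ) - 1 / 2)) = (A ^ (-(2 * (N : ℝ) - 1 / 2) / N)) ^ N := by
    rw [← Real.rpow_natCast (_ ^ _), ← Real.rpow_mul hA.le, div_mul_cancel₀]
    linarith
  rw [et, eA, mul_comm (_ ^ N), mul_assoc (_ ^ s)]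
  gcongr

theorem I1_estimate_delta (n m s : ℕ) (hm : 0 < m) (hmn : m < n) (k h : ℤ)
    (hk : 2 * (n : ℤ) - 2 * (m : ℤ) ≤ k)
    (hkh : k + h - (s : ℤ) ≤ 2 * (n : ℤ) - (m : ℤ) - 1) :
    ∃ C > (0 : ℝ),
      ∀ ε ∈ Set.Ioo (0 : ℝ) 1, ∀ δ ∈ Set.Ioo (0 : ℝ) 1,
        (∫ x : (Fin s → ℝ) × (Fin m → ℝ) × (Fin (n - m) → ℂ) in
            {p : (Fin s → ℝ) × (Fin m → ℝ) × (Fin (n - m) → ℂ) |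
              (∑ i, |p.1 i|) + (∑ i, |p.2.1 i|) + (∑ i, ‖p.2.2 i‖ ^ 2) < δ ^ 2},
          (ε + (∑ i, |x.1 i|) + (∑ i, |x.2.1 i|) + ∑ i, ‖x.2.2 i‖) ^ (-k) *
            (Real.sqrt ε + (∑ i, Real.sqrt |x.1 i|) + (∑ i, Real.sqrt |x.2.1 i|) +
              ∑ i, ‖x.2.2 i‖) ^ (-(2 * h)))
        ≤ C * δ := by
  obtain ⟨N, hN⟩ : ∃ N, N = n - m := ⟨_, rfl⟩
  rw [← hN]
  have hN0 : 0 < N := by omega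
  obtain ⟨j, hj⟩ : ∃ j : ℕ, k = 2 * N + j := ⟨(k - 2 * N).toNat, by omega⟩
  obtain ⟨l, hl⟩ : ∃ l : ℕ, h = (s + m : ℕ) - 1 - j - l :=
    ⟨((s + m : ℕ) - 1 - j - h).toNat, by omega⟩
  have hd : 1 ≤ s + m := by omega
  have hdR : (1 : ℝ) ≤ ((s + m : ℕ) : ℝ) := by exact_mod_cast hd
  have hNR : (1 : ℝ) ≤ (N : ℝ) := by exact_mod_cast hN0
  set c : ℝ := -(((s + m : ℕ) : ℝ) - 1 / 2) / (s + m : ℕ) with hc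
  set c' : ℝ := -(2 * (N : ℝ) - 1 / 2) / N with hc'
  have hc1 : c + 1 = 1 / (2 * (s + m : ℕ)) := by
    have : ((s + m : ℕ) : ℝ) ≠ 0 := by linarith
    rw [hc]; generalize ((s + m : ℕ) : ℝ) = D at *
    field_simp; ring
  have hc1' : -2 < c' := by
    rw [hc', lt_div_iff₀ (by linarith)]; linarith
  have hcpos : 0 < c + 1 := by rw [hc1]; positivity
  have hpsi := aux_psi c' hc1'
  set I := ∫ x, (Metric.ball (0 : ℂ) 1).indicator (fun x => ‖x‖ ^ c') x with hI
  have hI0 : 0 ≤ I := integral_nonneg fun x =>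
    Set.indicator_nonneg (fun _ _ => Real.rpow_nonneg (norm_nonneg _) _) _
  set M : ℝ := ((1 + s + m + N : ℝ) ^ 2) ^ (j + l) with hM
  have hM0 : 0 < M := by positivity
  refine ⟨M * ((2 / (c + 1)) ^ (s + m) * I ^ N) + 1, by positivity, ?_⟩
  rintro ε ⟨hε, hε1⟩ δ ⟨hδ, hδ1⟩
  obtain ⟨hphi, hphiI⟩ := aux_phi c (δ ^ 2) (by linarith) (by positivity)
  set φ : ℝ → ℝ := (Metric.ball (0 : ℝ) (δ ^ 2)).indicator (fun x => ‖x‖ ^ c) with hφ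
  set ψ : ℂ → ℝ := (Metric.ball (0 : ℂ) 1).indicator (fun x => ‖x‖ ^ c') with hψ
  have hφ0 : ∀ x, 0 ≤ φ x :=
    Set.indicator_nonneg (fun _ _ => Real.rpow_nonneg (norm_nonneg _) _)
  have hψ0 : ∀ x, 0 ≤ ψ x :=
    Set.indicator_nonneg (fun _ _ => Real.rpow_nonneg (norm_nonneg _) _)
  let G : (Fin s → ℝ) × (Fin m → ℝ) × (Fin N → ℂ) → ℝ := fun x =>
    (∏ i, φ (x.1 i)) * ((∏ i, φ (x.2.1 i)) * ∏ i, ψ (x.2.2 i))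
  have hGint : Integrable G := by
    have i1 : Integrable (fun x : Fin s → ℝ => ∏ i, φ (x i)) :=
      Integrable.fintype_prod (f := fun _ => φ) fun _ => hphi
    have i2 : Integrable (fun x : Fin m → ℝ => ∏ i, φ (x i)) :=
      Integrable.fintype_prod (f := fun _ => φ) fun _ => hphi
    have i3 : Integrable (fun x : Fin N → ℂ => ∏ i, ψ (x i)) :=
      Integrable.fintype_prod (f := fun _ => ψ) fun _ => hpsi
    exact i1.mul_prod (i2.mul_prod i3)
  have hG0 : ∀ x, 0 ≤ G x := fun x => by
    have h1 := Finset.prod_nonneg (s := Finset.univ) fun i _ => hφ0 (x.1 i)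
    have h2 := Finset.prod_nonneg (s := Finset.univ) fun i _ => hφ0 (x.2.1 i)
    have h3 := Finset.prod_nonneg (s := Finset.univ) fun i _ => hψ0 (x.2.2 i)
    exact mul_nonneg h1 (mul_nonneg h2 h3)
  have hGI : ∫ x, G x = (2 / (c + 1)) ^ (s + m) * I ^ N * δ := by
    have e1 : ∫ x, G x = (∫ x : Fin s → ℝ, ∏ i, φ (x i)) *
        ((∫ x : Fin m → ℝ, ∏ i, φ (x i)) * ∫ x : Fin N → ℂ, ∏ i, ψ (x i)) := by
      have e2 := integral_prod_mul (μ := (volume : Measure (Fin m → ℝ)))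
        (ν := (volume : Measure (Fin N → ℂ))) (fun x => ∏ i, φ (x i)) (fun x => ∏ i, ψ (x i))
      rw [← e2]
      exact integral_prod_mul (μ := (volume : Measure (Fin s → ℝ)))
        (ν := (volume : Measure ((Fin m → ℝ) × (Fin N → ℂ)))) (fun x => ∏ i, φ (x i))
        (fun x => (∏ i, φ (x.1 i)) * ∏ i, ψ (x.2 i))
    rw [e1, integral_fintype_prod_volume_eq_prod (fun _ => φ),
      integral_fintype_prod_volume_eq_prod (fun _ => φ),
      integral_fintype_prod_volume_eq_prod (fun _ => ψ)]
    simp only [Finset.prod_const, Finset.card_univ, Fintype.card_fin]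
    rw [← hI, ← mul_assoc, ← pow_add, hphiI]
    have e3 : ((δ ^ 2) ^ (c + 1)) ^ (s + m) = δ := by
      rw [← Real.rpow_natCast, ← Real.rpow_natCast δ 2, ← Real.rpow_mul hδ.le,
        ← Real.rpow_mul hδ.le, hc1]
      have : ((s + m : ℕ) : ℝ) ≠ 0 := by linarith
      rw [show ((2 : ℕ) : ℝ) * (1 / (2 * ((s + m : ℕ) : ℝ))) * ((s + m : ℕ) : ℝ) = 1 by
        generalize ((s + m : ℕ) : ℝ) = D at *
        push_cast
        field_simp]
      exact Real.rpow_one _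
    rw [show 2 * ((δ ^ 2) ^ (c + 1) / (c + 1)) = 2 / (c + 1) * (δ ^ 2) ^ (c + 1) by ring,
      mul_pow, e3]
    ring
  have hmeas : MeasurableSet {p : (Fin s → ℝ) × (Fin m → ℝ) × (Fin N → ℂ) |
      (∑ i, |p.1 i|) + (∑ i, |p.2.1 i|) + (∑ i, ‖p.2.2 i‖ ^ 2) < δ ^ 2} :=
    (isOpen_lt (by fun_prop) (by fun_prop)).measurableSet
  have hGM : Integrable (fun x => M * G x) := hGint.const_mul M
  calc _ ≤ ∫ x in {p : (Fin s → ℝ) × (Fin m → ℝ) × (Fin N → ℂ) |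
      (∑ i, |p.1 i|) + (∑ i, |p.2.1 i|) + (∑ i, ‖p.2.2 i‖ ^ 2) < δ ^ 2}, M * G x := by
        apply integral_mono_of_nonneg
        · refine Filter.Eventually.of_forall fun x => ?_
          have := Finset.sum_nonneg (s := Finset.univ) fun i _ => abs_nonneg (x.1 i)
          have := Finset.sum_nonneg (s := Finset.univ) fun i _ => abs_nonneg (x.2.1 i)
          have := Finset.sum_nonneg (s := Finset.univ) fun i _ => norm_nonneg (x.2.2 i)
          have := Finset.sum_nonneg (s := Finset.univ) fun i _ => Real.sqrt_nonneg |x.1 i|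
          have := Finset.sum_nonneg (s := Finset.univ) fun i _ => Real.sqrt_nonneg |x.2.1 i|
          have := Real.sqrt_nonneg ε
          exact mul_nonneg (zpow_nonneg (by linarith) _) (zpow_nonneg (by linarith) _)
        · exact hGM.integrableOn
        · filter_upwards [ae_restrict_mem hmeas, ae_restrict_of_ae (aux_ae s m N)] with x hx hx0
          exact aux_point s m N hm hN0 k h j l hj hl ε δ hε hε1 hδ hδ1 x.1 x.2.1 x.2.2 hx
            hx0.1 hx0.2.1 hx0.2.2
    _ ≤ ∫ x, M * G x := setIntegral_le_integral hGM
        (Filter.Eventually.of_forall fun x => mul_nonneg hM0.le (hG0 x))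
    _ = M * ((2 / (c + 1)) ^ (s + m) * I ^ N) * δ := by
        rw [integral_const_mul, hGI]; ring
    _ ≤ _ := by gcongr; linarith
end

section
/- Let $0<m<n$, $s\ge 0$ integers, $k,h\in\mathbb{Z}$, and consider on $\mathbb{R}^s\times\mathbb{R}^m\times\mathbb{C}^{n-m}$ (coordinates $(\rho,\eta,w)$, Lebesgue measure) the kernel $K\{0,k,h,s\}(\rho,\eta,w,\epsilon)=\big(\epsilon+\sum_{i=1}^s|\rho_i|+\sum_{i=1}^m|\eta_i|+\sum_{i=1}^{n-m}|w_i|\big)^{-k}\big(\sqrt{\epsilon}+\sum_{i=1}^s\sqrt{|\rho_i|}+\sum_{i=1}^m\sqrt{|\eta_i|}+\sum_{i=1}^{n-m}|w_i|\big)^{-2h}$ and $\mathcal{I}_1\{0,k,h,s\}(\epsilon,\delta)=\int_{\mathbf{V}(\delta)}K\{0,k,h,s\}(\rho,\eta,w,\epsilon)\,d\lambda$. If $k\le 2n-2m-1$ and $k+2(h-s)\ge 2n$, then there exist $C>0$ and $\epsilon_0\in(0,1)$ such that for all $\epsilon\in(0,\epsilon_0)$ and all $\delta\in(0,1)$ one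 has $\mathcal{I}_1\{0,k,h,s\}(\epsilon,\delta)\le C\,\epsilon^{(2n-k-2(h-s))/2}\,\log(1/\epsilon)$. -/
open MeasureTheory
open Set

lemma polar_le {E : Type*} [NormedAddCommGroup E] [NormedSpace ℝ E] [MeasurableSpace E]
    [Nontrivial E] (μ : Measure E) [FiniteDimensional ℝ E] [BorelSpace E] [μ.IsAddHaarMeasure]
    (g G : ℝ → ℝ) (hg : Measurable g) (hg0 : ∀ r, 0 ≤ r → 0 ≤ g r)
    (hG : IntegrableOn G (Ioi 0))
    (hgG : ∀ r, 0 < r → r ^ (Module.finrank ℝ E - 1) * g r ≤ G r) :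
    ∫⁻ x, ENNReal.ofReal (g ‖x‖) ∂μ ≤
      ENNReal.ofReal ((Module.finrank ℝ E * μ.real (Metric.ball 0 1)) * ∫ r in Ioi (0:ℝ), G r) := by
  have hint : IntegrableOn (fun y : ℝ ↦ y ^ (Module.finrank ℝ E - 1) • g y) (Ioi 0) := by
    refine Integrable.mono' hG ?_ ?_
    · exact Measurable.aestronglyMeasurable (by fun_prop)
    · refine (ae_restrict_mem measurableSet_Ioi).mono fun r hr => ?_
      have hr : 0 < r := hr
      have := hg0 r hr.le
      rw [smul_eq_mul, Real.norm_of_nonneg (by positivity)]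
      exact hgG r hr
  have h2 := (integrable_fun_norm_addHaar μ (f := g)).2 hint
  rw [← ofReal_integral_eq_lintegral_ofReal h2 (.of_forall fun x => hg0 _ (norm_nonneg _)),
    integral_fun_norm_addHaar μ g]
  apply ENNReal.ofReal_le_ofReal
  rw [nsmul_eq_mul, smul_eq_mul, ← mul_assoc]
  refine mul_le_mul_of_nonneg_left ?_ (by positivity)
  refine setIntegral_mono_on hint hG measurableSet_Ioi fun r hr => ?_
  exact hgG r hr

lemma int_shift (S q : ℝ) (hS : 0 < S) (hq : 0 < q) :
    ∫ r in Ioi (0:ℝ), (r + S) ^ (-(q+1)) = S ^ (-q) / q := by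
  have h1 := (measurePreserving_add_right (volume : Measure ℝ) S).setIntegral_preimage_emb
    (measurableEmbedding_addRight S) (fun r : ℝ => r ^ (-(q+1))) (Ioi S)
  have h2 : (fun x : ℝ => x + S) ⁻¹' Ioi S = Ioi 0 := by ext x; simp
  rw [h2] at h1
  rw [h1, integral_Ioi_rpow_of_lt (by linarith) hS]
  rw [show -(q+1)+1 = -q by ring, neg_div_neg_eq]

lemma inner_le {E : Type*} [NormedAddCommGroup E] [NormedSpace ℝ E] [MeasurableSpace E]
    [Nontrivial E] (μ : Measure E) [FiniteDimensional ℝ E] [BorelSpace E] [μ.IsAddHaarMeasure]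
    (S q : ℝ) (hS : 0 < S) (hq : 0 < q) :
    ∫⁻ x, ENNReal.ofReal ((S + ‖x‖) ^ (-(q + (Module.finrank ℝ E : ℝ)))) ∂μ ≤
      ENNReal.ofReal ((Module.finrank ℝ E * μ.real (Metric.ball 0 1)) * (S ^ (-q) / q)) := by
  rw [← int_shift S q hS hq]
  refine polar_le μ (fun r => (S + r) ^ (-(q + (Module.finrank ℝ E : ℝ)))) _ (by fun_prop) ?_ ?_ ?_
  · intro r hr; positivity
  · exact integrableOn_add_rpow_Ioi_of_lt (by linarith) (by linarith)
  · intro r hr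
    have hd : 0 < Module.finrank ℝ E := Module.finrank_pos
    calc r ^ (Module.finrank ℝ E - 1) * (S + r) ^ (-(q + (Module.finrank ℝ E : ℝ)))
        ≤ (r + S) ^ (Module.finrank ℝ E - 1) * (r + S) ^ (-(q + (Module.finrank ℝ E : ℝ))) := by
          rw [add_comm S r]
          gcongr; linarith
      _ = _ := by
          rw [← Real.rpow_natCast, ← Real.rpow_add (by linarith)]
          congr 1
          rw [Nat.cast_sub hd]; push_cast; ring

lemma outer_pt (ε r : ℝ) (hε : 0 < ε) (hr : 0 < r) (N j : ℕ) (hj : j + 1 ≤ 2 * N) :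
    r ^ (2 * N - 1) * (((ε + r) ^ j)⁻¹ * (ε + r ^ 2) ^ (-((N : ℝ) - j / 2))) ≤
      2 * (r + √ε)⁻¹ := by
  have e1 : r ^ (2 * N - 1) = r ^ j * r ^ (2 * N - 1 - j) := by
    rw [← pow_add]; congr 1; omega
  have h1 : r ^ j ≤ (ε + r) ^ j := by gcongr; linarith
  have h2 : r ^ (2 * N - 1 - j) ≤ (ε + r ^ 2) ^ (((2 * N - 1 - j : ℕ) : ℝ) / 2) := by
    calc r ^ (2 * N - 1 - j) = (r ^ 2) ^ (((2 * N - 1 - j : ℕ) : ℝ) / 2) := by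
          rw [← Real.rpow_natCast r 2, ← Real.rpow_mul hr.le, ← Real.rpow_natCast]
          congr 1; push_cast; ring
      _ ≤ _ := by gcongr; linarith
  have e2 : (((2 * N - 1 - j : ℕ) : ℝ) / 2) = ((N : ℝ) - j / 2) - 1 / 2 := by
    rw [show 2 * N - 1 - j = 2 * N - (j + 1) by omega, Nat.cast_sub hj]; push_cast; ring
  have h3 : r ^ (2 * N - 1) ≤ (ε + r) ^ j * (ε + r ^ 2) ^ (((N : ℝ) - j / 2) - 1 / 2) := by
    rw [e1, ← e2]; gcongr
  have hT : 0 < ε + r ^ 2 := by positivity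
  calc _ ≤ ((ε + r) ^ j * (ε + r ^ 2) ^ (((N : ℝ) - j / 2) - 1 / 2)) *
        (((ε + r) ^ j)⁻¹ * (ε + r ^ 2) ^ (-((N : ℝ) - j / 2))) := by gcongr
    _ = (ε + r ^ 2) ^ (((N : ℝ) - j / 2) - 1 / 2) * (ε + r ^ 2) ^ (-((N : ℝ) - j / 2)) := by
        have : (ε + r) ^ j ≠ 0 := by positivity
        field_simp
    _ = (√(ε + r ^ 2))⁻¹ := by
        rw [← Real.rpow_add hT, Real.sqrt_eq_rpow, ← Real.rpow_neg hT.le]; congr 1; ring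
    _ ≤ ((r + √ε) / 2)⁻¹ := by
        have : 0 < √ε := Real.sqrt_pos.2 hε
        apply inv_anti₀ (by positivity)
        apply Real.le_sqrt_of_sq_le
        nlinarith [Real.sq_sqrt hε.le, sq_nonneg (r - √ε)]
    _ = _ := by rw [inv_div, div_eq_mul_inv]

lemma outer_int (ε : ℝ) (hε : 0 < ε) (hε' : ε < 1 / 4) :
    IntegrableOn (indicator (Iio 1) fun r : ℝ => 2 * (r + √ε)⁻¹) (Ioi 0) ∧
    ∫ r in Ioi (0:ℝ), indicator (Iio 1) (fun r : ℝ => 2 * (r + √ε)⁻¹) r ≤ 3 * Real.log (1 / ε) := by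
  have hs : 0 < √ε := Real.sqrt_pos.2 hε
  have hc : IntegrableOn (fun r : ℝ => 2 * (r + √ε)⁻¹) (Icc 0 1) := by
    apply ContinuousOn.integrableOn_Icc
    apply ContinuousOn.mul continuousOn_const
    apply ContinuousOn.inv₀ (by fun_prop)
    intro x hx; have := hx.1; positivity
  constructor
  · rw [IntegrableOn, integrable_indicator_iff measurableSet_Iio, IntegrableOn,
      Measure.restrict_restrict measurableSet_Iio]
    exact hc.mono_set fun x hx => ⟨le_of_lt hx.2, le_of_lt hx.1⟩
  · rw [setIntegral_indicator measurableSet_Iio, Ioi_inter_Iio, ← integral_Ioc_eq_integral_Ioo,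
      ← intervalIntegral.integral_of_le zero_le_one, intervalIntegral.integral_const_mul,
      intervalIntegral.integral_comp_add_right (fun x : ℝ => x⁻¹),
      integral_inv_of_pos (by positivity) (by positivity)]
    have hlog : Real.log √ε = Real.log ε / 2 := Real.log_sqrt hε.le
    have hl4 : Real.log ε ≤ - (2 * Real.log 2) := by
      have := Real.log_le_log hε hε'.le
      rw [one_div, Real.log_inv, show (4:ℝ) = 2 ^ 2 by norm_num, Real.log_pow] at this
      exact_mod_cast this
    have h1 : Real.log (1 + √ε) ≤ Real.log 2 := by
      apply Real.log_le_log (by positivity)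
      have : √ε ≤ 1 := Real.sqrt_le_one.2 (by linarith)
      linarith
    rw [Real.log_div (by positivity) (by positivity), zero_add, hlog, one_div, Real.log_inv]
    linarith [Real.log_pos one_lt_two]

lemma outer_le {E : Type*} [NormedAddCommGroup E] [NormedSpace ℝ E] [MeasurableSpace E]
    [Nontrivial E] (μ : Measure E) [FiniteDimensional ℝ E] [BorelSpace E] [μ.IsAddHaarMeasure]
    (ε : ℝ) (hε : 0 < ε) (hε' : ε < 1 / 4) (N j : ℕ) (hj : j + 1 ≤ 2 * N)
    (hN : Module.finrank ℝ E = 2 * N) :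
    ∫⁻ w, ENNReal.ofReal (indicator (Iio 1)
      (fun r => ((ε + r) ^ j)⁻¹ * (ε + r ^ 2) ^ (-((N : ℝ) - j / 2))) ‖w‖) ∂μ ≤
      ENNReal.ofReal ((Module.finrank ℝ E * μ.real (Metric.ball 0 1)) *
        (3 * Real.log (1 / ε))) := by
  obtain ⟨h1, h2⟩ := outer_int ε hε hε'
  refine (polar_le μ _ _ ?_ ?_ h1 ?_).trans ?_
  · exact Measurable.indicator (by fun_prop) measurableSet_Iio
  · intro r hr
    apply indicator_apply_nonneg; intro _; positivity
  · intro r hr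
    by_cases h : r < 1
    · simp only [indicator, mem_Iio, h, if_true, hN]
      exact outer_pt ε r hε hr N j hj
    · simp [indicator, h]
  · apply ENNReal.ofReal_le_ofReal
    gcongr

lemma kernel_le (ε A B v T : ℝ) (hε : 0 < ε) (hv : 0 ≤ v) (hA : √ε ≤ A) (hBA : B ≤ A)
    (hvB : ε + v ≤ B) (hT : 0 < T) (hTA : T ≤ A ^ 2) (k h : ℤ) (a Q : ℕ)
    (hh : 2 * h = a + Q - k) (hkQ : k ≤ Q) :
    B ^ (-k) * A ^ (-(2 * h)) ≤
      ε ^ (-(a : ℝ) / 2) * (((ε + v) ^ k.toNat)⁻¹ * T ^ (-(((Q : ℝ) - k.toNat) / 2))) := by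
  have hs : 0 < √ε := Real.sqrt_pos.2 hε
  have hA0 : 0 < A := by linarith
  have hB0 : 0 < B := by linarith
  have key : ∀ b : ℕ, (A ^ b)⁻¹ ≤ T ^ (-((b : ℝ) / 2)) := by
    intro b
    rw [Real.rpow_neg hT.le]
    apply inv_anti₀ (by positivity)
    calc T ^ ((b : ℝ) / 2) ≤ (A ^ 2) ^ ((b : ℝ) / 2) := by gcongr
      _ = A ^ b := by
        rw [← Real.rpow_natCast A 2, ← Real.rpow_mul hA0.le, ← Real.rpow_natCast]
        congr 1; push_cast; ring
  have ha : (A ^ a)⁻¹ ≤ ε ^ (-(a : ℝ) / 2) := by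
    have : (√ε) ^ a = ε ^ ((a : ℝ) / 2) := by
      rw [Real.sqrt_eq_rpow, ← Real.rpow_natCast, ← Real.rpow_mul hε.le]; congr 1; ring
    rw [neg_div, Real.rpow_neg hε.le, ← this]
    gcongr
  obtain ⟨j, rfl | rfl⟩ := k.eq_nat_or_neg
  · obtain ⟨b, rfl⟩ : ∃ b, Q = j + b := ⟨Q - j, by omega⟩
    have e : -(2 * h) = -(a : ℤ) + -(b : ℤ) := by push_cast at hh; omega
    rw [e, zpow_add₀ hA0.ne', zpow_neg, zpow_neg, zpow_neg]
    simp only [zpow_natCast, Int.toNat_natCast]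
    have e2 : (((j + b : ℕ) : ℝ) - j) / 2 = b / 2 := by push_cast; ring
    rw [e2]
    calc (B ^ j)⁻¹ * ((A ^ a)⁻¹ * (A ^ b)⁻¹) = (A ^ a)⁻¹ * ((B ^ j)⁻¹ * (A ^ b)⁻¹) := by ring
      _ ≤ _ := by
        have := key b
        gcongr
  · have e : -(2 * h) = -(j : ℤ) + (-(a : ℤ) + -(Q : ℤ)) := by omega
    have e0 : (-(j : ℤ)).toNat = 0 := by omega
    rw [e, e0, zpow_add₀ hA0.ne', zpow_add₀ hA0.ne', neg_neg, zpow_neg, zpow_neg, zpow_neg]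
    simp only [zpow_natCast, Nat.cast_zero, sub_zero, pow_zero, inv_one, one_mul]
    have h1 : B ^ j * (A ^ j)⁻¹ ≤ 1 := by
      rw [← div_eq_mul_inv]; apply div_le_one_of_le₀ (by gcongr) (by positivity)
    calc B ^ j * ((A ^ j)⁻¹ * ((A ^ a)⁻¹ * (A ^ Q)⁻¹))
        = (B ^ j * (A ^ j)⁻¹) * ((A ^ a)⁻¹ * (A ^ Q)⁻¹) := by ring
      _ ≤ 1 * ((A ^ a)⁻¹ * (A ^ Q)⁻¹) := by gcongr
      _ ≤ _ := by
        rw [one_mul]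
        have := key Q
        gcongr

lemma geom (s m N : ℕ) (ρ : Fin s → ℝ) (η : Fin m → ℝ) (w : Fin N → ℂ) (ε δ : ℝ)
    (hε : 0 < ε) (hε1 : ε < 1) (hδ : 0 < δ) (hδ1 : δ < 1)
    (hV : (∑ i, |ρ i|) + (∑ i, |η i|) + (∑ i, ‖w i‖ ^ 2) < δ ^ 2) :
    let A := √ε + (∑ i, √|ρ i|) + (∑ i, √|η i|) + ∑ i, ‖w i‖
    let B := ε + (∑ i, |ρ i|) + (∑ i, |η i|) + ∑ i, ‖w i‖
    √ε ≤ A ∧ B ≤ A ∧ ε + ‖w‖ ≤ B ∧ ε + ‖w‖ ^ 2 + ‖(ρ, η)‖ ≤ A ^ 2 ∧ ‖w‖ < 1 := by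
  intro A B
  have hρ0 : 0 ≤ ∑ i, |ρ i| := by positivity
  have hη0 : 0 ≤ ∑ i, |η i| := by positivity
  have hw0 : 0 ≤ ∑ i, ‖w i‖ := by positivity
  have hw20 : 0 ≤ ∑ i, ‖w i‖ ^ 2 := by positivity
  have hρs0 : 0 ≤ ∑ i, √|ρ i| := by positivity
  have hηs0 : 0 ≤ ∑ i, √|η i| := by positivity
  have hd : δ ^ 2 < 1 := by nlinarith
  have hs : 0 ≤ √ε := Real.sqrt_nonneg _
  have hss : √ε ^ 2 = ε := Real.sq_sqrt hε.le
  have aux : ∀ x : ℝ, 0 ≤ x → x ≤ 1 → x ≤ √x := fun x h0 h1 =>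
    Real.le_sqrt_of_sq_le (by nlinarith)
  have gen : ∀ (l : ℕ) (x : Fin l → ℝ), (∑ i, |x i|) ≤ 1 →
      (∑ i, |x i|) ≤ (∑ i, √|x i|) ∧ ‖x‖ ≤ (∑ i, √|x i|) ^ 2 := by
    intro l x hx
    constructor
    · refine Finset.sum_le_sum fun i _ => aux _ (abs_nonneg _) ?_
      exact (Finset.single_le_sum (f := fun i => |x i|) (fun i _ => abs_nonneg _)
        (Finset.mem_univ i)).trans hx
    · rw [pi_norm_le_iff_of_nonneg (by positivity)]
      intro i
      have := Finset.single_le_sum (f := fun i => √|x i|) (fun i _ => Real.sqrt_nonneg _)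
        (Finset.mem_univ i)
      rw [Real.norm_eq_abs, ← Real.sq_sqrt (abs_nonneg (x i))]
      gcongr
  obtain ⟨r1, r2⟩ := gen s ρ (by linarith)
  obtain ⟨e1, e2⟩ := gen m η (by linarith)
  have hw : ‖w‖ ≤ ∑ i, ‖w i‖ := by
    rw [pi_norm_le_iff_of_nonneg (by positivity)]
    intro i
    exact Finset.single_le_sum (f := fun i => ‖w i‖) (fun i _ => norm_nonneg _)
        (Finset.mem_univ i)
  have hεs := aux ε hε.le hε1.le
  refine ⟨by simp only [A]; linarith, by simp only [A, B]; linarith,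
    by simp only [B]; linarith, ?_, ?_⟩
  · have hp : ‖(ρ, η)‖ ≤ (∑ i, √|ρ i|) ^ 2 + (∑ i, √|η i|) ^ 2 := by
      rw [Prod.norm_mk]
      exact max_le (r2.trans (by nlinarith)) (e2.trans (by nlinarith))
    have hw2 : ‖w‖ ^ 2 ≤ (∑ i, ‖w i‖) ^ 2 := by gcongr
    have : ε + (∑ i, ‖w i‖) ^ 2 + ((∑ i, √|ρ i|) ^ 2 + (∑ i, √|η i|) ^ 2) ≤ A ^ 2 := by
      simp only [A]
      generalize (∑ i, √|ρ i|) = a at *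
      generalize (∑ i, √|η i|) = b at *
      generalize (∑ i, ‖w i‖) = c at *
      generalize √ε = e at *
      have := mul_nonneg hs hρs0
      have := mul_nonneg hs hηs0
      have := mul_nonneg hs hw0
      have := mul_nonneg hρs0 hηs0
      have := mul_nonneg hρs0 hw0
      have := mul_nonneg hηs0 hw0
      linarith [show (e + a + b + c) ^ 2 = e^2+a^2+b^2+c^2 +2*(e*a)+2*(e*b)+2*(e*c)+2*(a*b)+2*(a*c)+2*(b*c) by ring]
    linarith
  · rw [pi_norm_lt_iff zero_lt_one]
    intro i
    have := Finset.single_le_sum (f := fun i => ‖w i‖ ^ 2) (fun i _ => by positivity)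
        (Finset.mem_univ i)
    nlinarith [norm_nonneg (w i)]

/-- Lemma (Integral estimates), case `𝓘₁{0,k,h,s}` with `k ≤ 2n-2m-1` and `k+2(h-s) ≥ 2n`:
the integral of the kernel `K{0,k,h,s}` over `V(δ)` is `O(ε^((2n-k-2(h-s))/2) log ε)`. -/
theorem I1_estimate_half_log (n m s : ℕ) (hm : 0 < m) (hmn : m < n) (k h : ℤ)
    (hk : k ≤ 2 * (n : ℤ) - 2 * (m : ℤ) - 1)
    (hkh : 2 * (n : ℤ) ≤ k + 2 * (h - (s : ℤ))) :
    ∃ C > (0 : ℝ), ∃ ε₀ ∈ Set.Ioo (0 : ℝ) 1,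
      ∀ ε ∈ Set.Ioo (0 : ℝ) ε₀, ∀ δ ∈ Set.Ioo (0 : ℝ) 1,
        (∫ x : (Fin s → ℝ) × (Fin m → ℝ) × (Fin (n - m) → ℂ) in
            {p : (Fin s → ℝ) × (Fin m → ℝ) × (Fin (n - m) → ℂ) |
              (∑ i, |p.1 i|) + (∑ i, |p.2.1 i|) + (∑ i, ‖p.2.2 i‖ ^ 2) < δ ^ 2},
          (ε + (∑ i, |x.1 i|) + (∑ i, |x.2.1 i|) + ∑ i, ‖x.2.2 i‖) ^ (-k) *
            (Real.sqrt ε + (∑ i, Real.sqrt |x.1 i|) + (∑ i, Real.sqrt |x.2.1 i|) +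
              ∑ i, ‖x.2.2 i‖) ^ (-(2 * h)))
        ≤ C * ε ^ ((2 * (n : ℝ) - (k : ℝ) - 2 * ((h : ℝ) - (s : ℝ))) / 2) * Real.log (1 / ε) := by
  obtain ⟨N, rfl⟩ : ∃ N, n = m + N := ⟨n - m, by omega⟩
  rw [Nat.add_sub_cancel_left]
  have hN : 0 < N := by omega
  obtain ⟨a, ha⟩ : ∃ a : ℕ, (a : ℤ) = k + 2 * (h - s) - 2 * ((m + N : ℕ) : ℤ) :=
    ⟨(k + 2 * (h - s) - 2 * ((m + N : ℕ) : ℤ)).toNat, by omega⟩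
  obtain ⟨j, hj⟩ : ∃ j : ℕ, k.toNat = j := ⟨_, rfl⟩
  have hjN : j + 1 ≤ 2 * N := by push_cast at hk; omega
  have : Nonempty (Fin m) := ⟨⟨0, hm⟩⟩
  have : Nonempty (Fin N) := ⟨⟨0, hN⟩⟩
  let E := (Fin s → ℝ) × (Fin m → ℝ)
  let W := Fin N → ℂ
  have hHaar : (volume : Measure E).IsAddHaarMeasure :=
    Measure.prod.instIsAddHaarMeasure _ _
  have hdE : Module.finrank ℝ E = s + m := by simp [E]
  have hdW : Module.finrank ℝ W = 2 * N := by
    simp [W, Module.finrank_pi_fintype, mul_comm]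
  let q : ℝ := (N : ℝ) - j / 2
  have hq : 0 < q := by
    have : (j : ℝ) + 1 ≤ 2 * N := by exact_mod_cast hjN
    simp only [q]; linarith
  let c1 : ℝ := Module.finrank ℝ E * (volume : Measure E).real (Metric.ball 0 1)
  let c2 : ℝ := Module.finrank ℝ W * (volume : Measure W).real (Metric.ball 0 1)
  have hc1 : 0 ≤ c1 := by positivity
  have hc2 : 0 ≤ c2 := by positivity
  refine ⟨c1 / q * (c2 * 3) + 1, by positivity, 1 / 4, ⟨by norm_num, by norm_num⟩, ?_⟩
  rintro ε ⟨hε, hε'⟩ δ ⟨hδ, hδ'⟩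
  have hlog : 0 ≤ Real.log (1 / ε) := Real.log_nonneg (by rw [le_div_iff₀ hε]; linarith)
  have hexp : ((2 * ((m + N : ℕ) : ℝ) - (k : ℝ) - 2 * ((h : ℝ) - (s : ℝ))) / 2) = -(a : ℝ) / 2 := by
    have : (a : ℝ) = k + 2 * (h - s) - 2 * ((m + N : ℕ) : ℝ) := by exact_mod_cast ha
    rw [this]; ring
  rw [hexp]
  set e := ε ^ (-(a : ℝ) / 2) with he
  have he0 : 0 ≤ e := by positivity
  -- dominating function
  let F : W → ℝ := fun w => indicator (Iio 1) (fun r => ((ε + r) ^ j)⁻¹) ‖w‖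
  have hF0 : ∀ w, 0 ≤ F w := fun w => indicator_apply_nonneg fun _ => by positivity
  have hFm : Measurable F := by
    have : Measurable (indicator (Iio (1:ℝ)) (fun r : ℝ => ((ε + r) ^ j)⁻¹)) :=
      Measurable.indicator (by fun_prop) measurableSet_Iio
    exact this.comp measurable_norm
  let D : E × W → ℝ := fun z =>
    e * (F z.2 * (ε + ‖z.2‖ ^ 2 + ‖z.1‖) ^ (-(q + (Module.finrank ℝ E : ℝ))))
  have hDm : Measurable D := by
    have := hFm.comp (measurable_snd : Measurable (Prod.snd : E × W → W))
    simp only [Function.comp_def] at this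
    fun_prop
  have hDint : ∫⁻ z, ENNReal.ofReal (D z) ≤
      ENNReal.ofReal (c1 / q * (c2 * 3) * e * Real.log (1 / ε)) := by
    rw [Measure.volume_eq_prod, lintegral_prod_symm' _ (by fun_prop)]
    calc _ ≤ ∫⁻ w : W, ENNReal.ofReal (e * (c1 / q)) * ENNReal.ofReal (indicator (Iio 1)
      (fun r => ((ε + r) ^ j)⁻¹ * (ε + r ^ 2) ^ (-((N : ℝ) - j / 2))) ‖w‖) := by
          refine lintegral_mono fun w => ?_
          have h1 := inner_le (volume : Measure E) (ε + ‖w‖ ^ 2) q (by positivity) hq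
          have h2 : ∀ x : E, ENNReal.ofReal (D (x, w)) = ENNReal.ofReal (e * F w) *
              ENNReal.ofReal ((ε + ‖w‖ ^ 2 + ‖x‖) ^ (-(q + (Module.finrank ℝ E : ℝ)))) := by
            intro x
            rw [← ENNReal.ofReal_mul (mul_nonneg he0 (hF0 w)), mul_assoc]
          simp only [h2]
          rw [lintegral_const_mul' _ _ ENNReal.ofReal_ne_top]
          refine (mul_le_mul_right h1 _).trans ?_
          rw [← ENNReal.ofReal_mul (mul_nonneg he0 (hF0 w)),
            ← ENNReal.ofReal_mul (by positivity)]
          apply ENNReal.ofReal_le_ofReal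
          apply le_of_eq
          by_cases hw : ‖w‖ < 1
          · simp only [F, indicator, mem_Iio, hw, if_true, q, c1]
            ring
          · simp [F, indicator, hw]
      _ ≤ ENNReal.ofReal (e * (c1 / q)) * ENNReal.ofReal (c2 * (3 * Real.log (1 / ε))) := by
          rw [lintegral_const_mul' _ _ ENNReal.ofReal_ne_top]
          exact mul_le_mul_right (outer_le (volume : Measure W) ε hε hε' N j hjN hdW) _
      _ = _ := by
          rw [← ENNReal.ofReal_mul (by positivity)]
          congr 1; ring
  refine (Real.le_norm_self _).trans ((norm_integral_le_lintegral_norm _).trans ?_)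
  refine ENNReal.toReal_le_of_le_ofReal (by positivity) ?_
  have hassoc : ∫⁻ p : (Fin s → ℝ) × (Fin m → ℝ) × (Fin N → ℂ),
      ENNReal.ofReal (D ((p.1, p.2.1), p.2.2)) = ∫⁻ z, ENNReal.ofReal (D z) := by
    have hmp := (volume_preserving_prodAssoc (α₁ := Fin s → ℝ) (β₁ := Fin m → ℝ) (γ₁ := Fin N → ℂ)).symm
    exact hmp.lintegral_comp_emb (MeasurableEquiv.measurableEmbedding _) (fun z => ENNReal.ofReal (D z))
  have hVm : MeasurableSet {p : (Fin s → ℝ) × (Fin m → ℝ) × (Fin N → ℂ) |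
              (∑ i, |p.1 i|) + (∑ i, |p.2.1 i|) + (∑ i, ‖p.2.2 i‖ ^ 2) < δ ^ 2} :=
    measurableSet_lt (by fun_prop) (by fun_prop)
  refine (setLIntegral_mono' hVm (g := fun p => ENNReal.ofReal (D ((p.1, p.2.1), p.2.2))) ?_).trans
    ((setLIntegral_le_lintegral _ _).trans ?_)
  · rintro ⟨ρ, η, w⟩ hp
    simp only [mem_ofPred_eq] at hp
    obtain ⟨g1, g2, g3, g4, g5⟩ := geom s m N ρ η w ε δ hε (by linarith) hδ hδ' hp
    apply ENNReal.ofReal_le_ofReal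
    simp only
    have hk1 := kernel_le ε _ _ ‖w‖ (ε + ‖w‖ ^ 2 + ‖(ρ, η)‖) hε (norm_nonneg _) g1 g2 g3
      (by positivity) g4 k h a (2 * (s + m + N)) (by push_cast at *; omega) (by push_cast at *; omega)
    rw [Real.norm_of_nonneg]
    · refine hk1.trans (le_of_eq ?_)
      simp only [D, F, indicator, mem_Iio, g5, if_true, hj, hdE, q]
      congr 4
      push_cast; ring
    · apply mul_nonneg <;> positivity
  · rw [hassoc]
    refine hDint.trans (ENNReal.ofReal_le_ofReal ?_)
    gcongr
    linarith
end

section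
/- Let $0<m<n$, $s\ge 0$ integers, $k,h\in\mathbb{Z}$, $0<\alpha<1$, and consider on $\mathbb{R}^s\times\mathbb{R}^m\times\mathbb{C}^{n-m}$ (coordinates $(\rho,\eta,w)$, Lebesgue measure) the kernel $K\{\alpha,k,h,s\}(\rho,\eta,w,\epsilon)=\big(\epsilon+\sum_{i=1}^s|\rho_i|+\sum_{i=1}^m|\eta_i|+\sum_{i=1}^{n-m}|w_i|\big)^{-k}\big(\sqrt{\epsilon}+\sum_{i=1}^s\sqrt{|\rho_i|}+\sum_{i=1}^m\sqrt{|\eta_i|}+\sum_{i=1}^{n-m}|w_i|\big)^{-(2h-\alpha)}$ and $\mathcal{I}_1\{\alpha,k,h,s\}(\epsilon,\delta)=\int_{\mathbf{V}(\delta)}K\{\alpha,k,h,s\}(\rho,\eta,w,\epsilon)\,d\lambda$. If either ($k\ge 2n-2m$ and $k+h-s\le 2n-m-1$) or ($k\le 2n-2m-1$ and $k+2(h-s)\le 2n$), then there exists $C>0$ such that for all $\epsilon\in(0,1)$ and all $\delta\in(0,1)$ one has $\mathcal{I}_1\{\alpha,k,h,s\}(\epsilon,\delta)\le C\,\delta^{\alpha}$.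 -/
open MeasureTheory

lemma aux_neg {x y e : ℝ} (hx : 0 < x) (hxy : x ≤ y) (he : 0 ≤ e) : y ^ (-e) ≤ x ^ (-e) :=
  Real.rpow_le_rpow_of_nonpos hx hxy (by linarith)

lemma aux_sq {r B p : ℝ} (hr : 0 < r) (hB : 0 < B) (h : r ≤ B ^ 2) (hp : 0 ≤ p) :
    B ^ (-(2 * p)) ≤ r ^ (-p) := by
  have h1 := aux_neg hr h hp
  rwa [← Real.rpow_natCast, ← Real.rpow_mul hB.le, show ((2 : ℕ) : ℝ) * -p = -(2 * p) by
    push_cast; ring] at h1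

/-- `A ^ (-(p+q)) ≤ r ^ (-p) * v ^ (-q)`. -/
lemma aux_A {r v A p q : ℝ} (hr : 0 < r) (hv : 0 < v) (hA : r + v ≤ A) (hp : 0 ≤ p) (hq : 0 ≤ q) :
    A ^ (-(p + q)) ≤ r ^ (-p) * v ^ (-q) := by
  have hA0 : 0 < A := by linarith
  rw [neg_add, Real.rpow_add hA0]
  exact mul_le_mul (aux_neg hr (by linarith) hp) (aux_neg hv (by linarith) hq)
    (by positivity) (by positivity)

lemma aux_B {r v B p q : ℝ} (hr : 0 < r) (hv : 0 < v) (hB : v ≤ B) (hB2 : r ≤ B ^ 2)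
    (hp : 0 ≤ p) (hq : 0 ≤ q) :
    B ^ (-(2 * p + q)) ≤ r ^ (-p) * v ^ (-q) := by
  have hB0 : 0 < B := by linarith
  rw [neg_add, Real.rpow_add hB0]
  exact mul_le_mul (aux_sq hr hB0 hB2 hp) (aux_neg hv hB hq)
    (by positivity) (by positivity)

lemma pointwise (T N κ η α M : ℝ) (hT : 1 ≤ T) (hN : 1 ≤ N) (hM : 1 ≤ M)
    (hα0 : 0 < α) (hα1 : α < 1) (hη : η ≤ 0 ∨ 1 ≤ η) (hκ : κ < 0 ∨ 0 ≤ κ)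
    (hcase : (2 * N ≤ κ ∧ κ + η ≤ T + 2 * N - 1) ∨
      (κ ≤ 2 * N - 1 ∧ κ + 2 * η ≤ 2 * T + 2 * N)) :
    ∃ p q C : ℝ, 0 ≤ p ∧ p < T ∧ 0 ≤ q ∧ q < 2 * N ∧ 2 * p + q ≤ 2 * T + 2 * N - α ∧ 0 < C ∧
      ∀ A B r v : ℝ, 0 < r → 0 < v → r + v ≤ A → v ≤ B → r ≤ B ^ 2 → A ≤ B → B ≤ M →
        B ^ 2 ≤ M ^ 2 * A →
        A ^ (-κ) * B ^ (-(2 * η - α)) ≤ C * (r ^ (-p) * v ^ (-q)) := by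
  rcases hcase with ⟨h1, h2⟩ | ⟨h1, h2⟩
  · rcases hη with hη | hη
    · -- case ii
      have key : ∀ A B r v : ℝ, 0 < r → 0 < v → r + v ≤ A → v ≤ B → r ≤ B ^ 2 → A ≤ B → B ≤ M →
        B ^ 2 ≤ M ^ 2 * A → A ^ (-κ) * B ^ (-(2 * η - α)) ≤
          (M ^ 2) ^ (-(η - α/2)) * A ^ (-(κ + η - α / 2)) := by
        intro A B r v hr hv hA hB hB2 hAB hBM hBA
        have hA0 : 0 < A := by linarith
        have hB0 : 0 < B := by linarith
        have e1 : B ^ (-(2 * η - α)) = (B ^ 2) ^ (-(η - α/2)) := by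
          rw [← Real.rpow_natCast, ← Real.rpow_mul hB0.le]
          congr 1; push_cast; ring
        have e2 : (B ^ 2) ^ (-(η - α/2)) ≤ (M ^ 2 * A) ^ (-(η - α/2)) :=
          Real.rpow_le_rpow (by positivity) hBA (by linarith)
        rw [Real.mul_rpow (by positivity) hA0.le] at e2
        calc _ ≤ A ^ (-κ) * ((M ^ 2) ^ (-(η - α/2)) * A ^ (-(η - α/2))) := by
              rw [e1]; gcongr
          _ = _ := by
              rw [show -(κ + η - α / 2) = -κ + -(η - α/2) by ring, Real.rpow_add hA0]; ring
      by_cases he : κ + η - α / 2 ≤ 0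
      · refine ⟨0, 0, (M ^ 2) ^ (-(η - α/2)) * M ^ (-(κ + η - α / 2)), le_rfl, by linarith, le_rfl,
          by linarith, by linarith, by positivity, ?_⟩
        intro A B r v hr hv hA hB hB2 hAB hBM hBA
        refine (key A B r v hr hv hA hB hB2 hAB hBM hBA).trans ?_
        simp only [neg_zero, Real.rpow_zero, mul_one]
        have : A ^ (-(κ + η - α / 2)) ≤ M ^ (-(κ + η - α / 2)) :=
          Real.rpow_le_rpow (by linarith) (by linarith) (by linarith)
        gcongr
      · push Not at he
        obtain ⟨p, q, hp, hq, hpq, hpT, hqN, hs⟩ : ∃ p q : ℝ, 0 ≤ p ∧ 0 ≤ q ∧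
            κ + η - α / 2 = p + q ∧ p < T ∧ q < 2 * N ∧ 2 * p + q ≤ 2 * T + 2 * N - α := by
          by_cases h3 : κ + η - α / 2 ≤ 2 * N - 1
          · exact ⟨0, κ + η - α / 2, by linarith, by linarith, by linarith, by linarith,
              by linarith, by linarith⟩
          · exact ⟨κ + η - α / 2 - (2 * N - 1), 2 * N - 1, by linarith, by linarith, by linarith,
              by linarith, by linarith, by linarith⟩
        refine ⟨p, q, (M ^ 2) ^ (-(η - α/2)), hp, hpT, hq, hqN, hs, by positivity, ?_⟩
        intro A B r v hr hv hA hB hB2 hAB hBM hBA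
        refine (key A B r v hr hv hA hB hB2 hAB hBM hBA).trans ?_
        rw [hpq]
        have := aux_A hr hv hA hp hq
        gcongr
    · -- case i
      refine ⟨κ + η - α / 2 - 2 * N + 1, 2 * N - 1, 1, by linarith, by linarith, by linarith,
        by linarith, by linarith, one_pos, ?_⟩
      intro A B r v hr hv hA hB hB2 hAB hBM hBA
      have hA0 : 0 < A := by linarith
      have hB0 : 0 < B := by linarith
      have a1 := aux_A hr hv hA (p := κ - (2 * N - 1)) (q := 2 * N - 1) (by linarith) (by linarith)
      have a2 := aux_sq hr hB0 hB2 (p := η - α / 2) (by linarith)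
      rw [show κ - (2 * N - 1) + (2 * N - 1) = κ by ring] at a1
      rw [show 2 * (η - α / 2) = 2 * η - α by ring] at a2
      calc _ ≤ (r ^ (-(κ - (2 * N - 1))) * v ^ (-(2 * N - 1))) * r ^ (-(η - α / 2)) :=
            mul_le_mul a1 a2 (by positivity) (by positivity)
        _ = _ := by
            rw [show -(κ + η - α / 2 - 2 * N + 1) = -(κ - (2 * N - 1)) + -(η - α / 2) by ring,
              Real.rpow_add hr]; ring
  · rcases hη with hη | hη
    · -- case iii
      rcases hκ with hκ | hκ
      · refine ⟨0, 0, M ^ (-κ) * M ^ (-(2 * η - α)), le_rfl, by linarith, le_rfl, by linarith,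
          by linarith, by positivity, ?_⟩
        intro A B r v hr hv hA hB hB2 hAB hBM hBA
        simp only [neg_zero, Real.rpow_zero, mul_one]
        exact mul_le_mul (Real.rpow_le_rpow (by linarith) (by linarith) (by linarith))
          (Real.rpow_le_rpow (by linarith) (by linarith) (by linarith))
          (Real.rpow_nonneg (by linarith) _) (by positivity)
      · refine ⟨0, κ, M ^ (-(2 * η - α)), le_rfl, by linarith, hκ, by linarith, by linarith,
          by positivity, ?_⟩
        intro A B r v hr hv hA hB hB2 hAB hBM hBA
        simp only [neg_zero, Real.rpow_zero, one_mul]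
        rw [mul_comm]
        exact mul_le_mul (Real.rpow_le_rpow (by linarith) (by linarith) (by linarith))
          (aux_neg hv (by linarith) hκ)
          (Real.rpow_nonneg (by linarith) _) (by positivity)
    · rcases hκ with hκ | hκ
      · -- case v
        have key : ∀ A B r v : ℝ, 0 < r → 0 < v → r + v ≤ A → v ≤ B → r ≤ B ^ 2 → A ≤ B → B ≤ M →
          B ^ 2 ≤ M ^ 2 * A → A ^ (-κ) * B ^ (-(2 * η - α)) ≤ B ^ (-(κ + 2 * η - α)) := by
          intro A B r v hr hv hA hB hB2 hAB hBM hBA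
          have hA0 : 0 < A := by linarith
          have hB0 : 0 < B := by linarith
          rw [show -(κ + 2 * η - α) = -κ + -(2 * η - α) by ring, Real.rpow_add hB0]
          have : A ^ (-κ) ≤ B ^ (-κ) := Real.rpow_le_rpow hA0.le hAB (by linarith)
          gcongr
        by_cases he : κ + 2 * η - α ≤ 0
        · refine ⟨0, 0, M ^ (-(κ + 2 * η - α)), le_rfl, by linarith, le_rfl,
            by linarith, by linarith, by positivity, ?_⟩
          intro A B r v hr hv hA hB hB2 hAB hBM hBA
          refine (key A B r v hr hv hA hB hB2 hAB hBM hBA).trans ?_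
          simp only [neg_zero, Real.rpow_zero, mul_one]
          exact Real.rpow_le_rpow (by linarith) (by linarith) (by linarith)
        · push Not at he
          obtain ⟨p, q, hp, hq, hpq, hpT, hqN⟩ : ∃ p q : ℝ, 0 ≤ p ∧ 0 ≤ q ∧
              κ + 2 * η - α = 2 * p + q ∧ p < T ∧ q < 2 * N := by
            by_cases h3 : κ + 2 * η - α ≤ 2 * N - α / 2
            · exact ⟨0, κ + 2 * η - α, by linarith, by linarith, by linarith, by linarith,
                by linarith⟩
            · exact ⟨(κ + 2 * η - α - (2 * N - α / 2)) / 2, 2 * N - α / 2, by linarith,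
                by linarith, by linarith, by linarith, by linarith⟩
          refine ⟨p, q, 1, hp, hpT, hq, hqN, by linarith, one_pos, ?_⟩
          intro A B r v hr hv hA hB hB2 hAB hBM hBA
          refine (key A B r v hr hv hA hB hB2 hAB hBM hBA).trans ?_
          rw [hpq, one_mul]
          exact aux_B hr hv hB hB2 hp hq
      · -- case iv
        obtain ⟨p, q, hp, hq, hpq, hpT, hqN⟩ : ∃ p q : ℝ, 0 ≤ p ∧ 0 ≤ q ∧
            2 * η - α = 2 * p + q ∧ p < T ∧ q + κ < 2 * N := by
          by_cases h3 : κ + 2 * η - α ≤ 2 * N - α / 2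
          · exact ⟨0, 2 * η - α, by linarith, by linarith, by linarith, by linarith,
              by linarith⟩
          · exact ⟨(κ + 2 * η - α - (2 * N - α / 2)) / 2, 2 * N - α / 2 - κ, by linarith,
              by linarith, by linarith, by linarith, by linarith⟩
        refine ⟨p, q + κ, 1, hp, hpT, by linarith, hqN, by linarith, one_pos, ?_⟩
        intro A B r v hr hv hA hB hB2 hAB hBM hBA
        have hA0 : 0 < A := by linarith
        have hB0 : 0 < B := by linarith
        have a1 := aux_B hr hv hB hB2 hp hq
        have a2 := aux_neg hv (show v ≤ A by linarith) hκ
        rw [hpq, neg_add q κ, Real.rpow_add hv]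
        calc _ ≤ v ^ (-κ) * (r ^ (-p) * v ^ (-q)) :=
              mul_le_mul a2 a1 (by positivity) (by positivity)
          _ = _ := by ring

noncomputable def phi {E : Type*} [NormedAddCommGroup E] (b R : ℝ) (x : E) : ℝ :=
  if ‖x‖ < R then ‖x‖ ^ (-b) else 0

lemma phi_nonneg {E : Type*} [NormedAddCommGroup E] (b R : ℝ) (x : E) : 0 ≤ phi b R x := by
  unfold phi; split_ifs <;> positivity

lemma phi_integrable {E : Type*} [NormedAddCommGroup E] [NormedSpace ℝ E] [MeasureSpace E]
    [Nontrivial E] [FiniteDimensional ℝ E] [BorelSpace E] [(volume : Measure E).IsAddHaarMeasure]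
    {b : ℝ} (R : ℝ) (hb : b < Module.finrank ℝ E) : Integrable (phi (E := E) b R) := by
  have h := (integrableOn_fun_norm_addHaar (volume : Measure E)
    (f := fun y : ℝ => y ^ (-b)) (r := R)).2 ?_
  · have := (integrable_indicator_iff Metric.isOpen_ball.measurableSet).2 h
    refine this.congr (Filter.Eventually.of_forall fun x => ?_)
    simp [phi, Set.indicator]
  · have hd : 1 ≤ Module.finrank ℝ E := Module.finrank_pos
    have h1 : IntegrableOn (fun y : ℝ => y ^ ((Module.finrank ℝ E : ℝ) - 1 - b)) (Set.Ioo 0 R) := by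
      rcases le_or_gt R 0 with hR | hR
      · simp [Set.Ioo_eq_empty_of_le hR]
      · rw [intervalIntegral.integrableOn_Ioo_rpow_iff hR]; linarith
    refine h1.congr_fun (fun y hy => ?_) measurableSet_Ioo
    simp only [smul_eq_mul]
    rw [← Real.rpow_natCast, ← Real.rpow_add hy.1]
    congr 1
    push_cast [Nat.cast_sub hd]; ring

lemma phi_integral {E : Type*} [NormedAddCommGroup E] [NormedSpace ℝ E] [MeasureSpace E]
    [FiniteDimensional ℝ E] [BorelSpace E] [(volume : Measure E).IsAddHaarMeasure]
    (b R : ℝ) (hR : 0 < R) :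
    ∫ x : E, phi b R x = R ^ ((Module.finrank ℝ E : ℝ) - b) * ∫ x : E, phi b 1 x := by
  have h := Measure.integral_comp_smul (volume : Measure E) (phi b R) R
  have h2 : ∀ x : E, phi b R (R • x) = R ^ (-b) * phi b 1 x := by
    intro x
    simp only [phi, norm_smul, Real.norm_of_nonneg hR.le]
    have : R * ‖x‖ < R ↔ ‖x‖ < 1 := by
      constructor <;> intro h <;> nlinarith
    simp only [this]
    split_ifs
    · rw [Real.mul_rpow hR.le (norm_nonneg _)]
    · simp
  simp only [h2, integral_const_mul, smul_eq_mul] at h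
  rw [abs_of_pos (by positivity)] at h
  rw [sub_eq_add_neg, Real.rpow_add hR, mul_assoc, h, Real.rpow_natCast]
  field_simp

lemma ae_ne {ι E : Type*} [Fintype ι] [NormedAddCommGroup E] [NormedSpace ℝ E] [MeasureSpace E]
    [Nontrivial E] [FiniteDimensional ℝ E] [BorelSpace E] [(volume : Measure E).IsAddHaarMeasure] :
    ∀ᵐ x : ι → E, ∀ i, x i ≠ 0 := by
  rw [ae_all_iff]
  intro i
  have h := Measure.quasiMeasurePreserving_eval (fun _ : ι => (volume : Measure E)) i
  exact h.ae (p := fun y => y ≠ 0) (by simp [ae_iff])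

lemma prod_bound {ι E : Type*} [Fintype ι] [NormedAddCommGroup E] (x : ι → E) (hx : ∀ i, x i ≠ 0)
    (R a r : ℝ) (ha : 0 ≤ a) (hR : ∀ i, ‖x i‖ < R) (hr : ∀ i, ‖x i‖ ≤ r) (hr0 : 0 < r) :
    r ^ (-(Fintype.card ι * a)) ≤ ∏ i, phi a R (x i) := by
  have h1 : r ^ (-(Fintype.card ι * a)) = ∏ _i : ι, r ^ (-a) := by
    rw [Finset.prod_const, Finset.card_univ, ← Real.rpow_natCast, ← Real.rpow_mul hr0.le]
    congr 1; ring
  rw [h1]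
  refine Finset.prod_le_prod (fun i _ => by positivity) fun i _ => ?_
  rw [phi, if_pos (hR i)]
  exact aux_neg (norm_pos_iff.2 (hx i)) (hr i) ha

lemma geom_s4 (n m s : ℕ) (ε : ℝ) (hε : ε ∈ Set.Ioo (0 : ℝ) 1)
    (x : Fin s → ℝ) (y : Fin m → ℝ) (w : Fin n → ℂ) (hx : ∀ i, |x i| ≤ 1) (hy : ∀ i, |y i| ≤ 1)
    (hw : ∀ i, ‖w i‖ ≤ 1) (A B r v M : ℝ)
    (hA : A = ε + (∑ i, |x i|) + (∑ i, |y i|) + ∑ i, ‖w i‖)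
    (hB : B = Real.sqrt ε + (∑ i, Real.sqrt |x i|) + (∑ i, Real.sqrt |y i|) + ∑ i, ‖w i‖)
    (hr : r = (∑ i, |x i|) + (∑ i, |y i|)) (hv : v = ∑ i, ‖w i‖) (hM : M = 1 + s + m + n) :
    r + v ≤ A ∧ v ≤ B ∧ r ≤ B ^ 2 ∧ A ≤ B ∧ B ≤ M ∧ B ^ 2 ≤ M ^ 2 * A := by
  obtain ⟨hε0, hε1⟩ := hε
  have sx : 0 ≤ ∑ i, |x i| := Finset.sum_nonneg fun i _ => abs_nonneg _
  have sy : 0 ≤ ∑ i, |y i| := Finset.sum_nonneg fun i _ => abs_nonneg _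
  have sw : 0 ≤ ∑ i, ‖w i‖ := Finset.sum_nonneg fun i _ => norm_nonneg _
  have tx : 0 ≤ ∑ i, √|x i| := Finset.sum_nonneg fun i _ => Real.sqrt_nonneg _
  have ty : 0 ≤ ∑ i, √|y i| := Finset.sum_nonneg fun i _ => Real.sqrt_nonneg _
  have te := Real.sqrt_nonneg ε
  have hB0 : 0 ≤ B := by rw [hB]; positivity
  have hA0 : 0 ≤ A := by rw [hA]; positivity
  have hle : ∀ u : ℝ, 0 ≤ u → u ≤ 1 → u ≤ √u := fun u h0 h1 => Real.le_sqrt_of_sq_le (by nlinarith)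
  have ux : ∑ i, |x i| ≤ ∑ i, √|x i| := Finset.sum_le_sum fun i _ => hle _ (abs_nonneg _) (hx i)
  have uy : ∑ i, |y i| ≤ ∑ i, √|y i| := Finset.sum_le_sum fun i _ => hle _ (abs_nonneg _) (hy i)
  have ue := hle ε hε0.le hε1.le
  have lx : ∀ i, |x i| ≤ ∑ i, |x i| := fun i =>
    Finset.single_le_sum (f := fun i => |x i|) (fun i _ => abs_nonneg _) (Finset.mem_univ i)
  have ly : ∀ i, |y i| ≤ ∑ i, |y i| := fun i =>
    Finset.single_le_sum (f := fun i => |y i|) (fun i _ => abs_nonneg _) (Finset.mem_univ i)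
  have lw : ∀ i, ‖w i‖ ≤ ∑ i, ‖w i‖ := fun i =>
    Finset.single_le_sum (f := fun i => ‖w i‖) (fun i _ => norm_nonneg _) (Finset.mem_univ i)
  have mx : ∀ i, √|x i| ≤ ∑ i, √|x i| := fun i =>
    Finset.single_le_sum (f := fun i => √|x i|) (fun i _ => Real.sqrt_nonneg _) (Finset.mem_univ i)
  have my : ∀ i, √|y i| ≤ ∑ i, √|y i| := fun i =>
    Finset.single_le_sum (f := fun i => √|y i|) (fun i _ => Real.sqrt_nonneg _) (Finset.mem_univ i)
  have gen : ∀ c : ℝ, √ε ≤ c → (∀ i, √|x i| ≤ c) → (∀ i, √|y i| ≤ c) → (∀ i, ‖w i‖ ≤ c) →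
      B ≤ M * c := by
    intro c h1 h2 h3 h4
    have e2 := Finset.sum_le_card_nsmul Finset.univ _ c (fun i _ => h2 i)
    have e3 := Finset.sum_le_card_nsmul Finset.univ _ c (fun i _ => h3 i)
    have e4 := Finset.sum_le_card_nsmul Finset.univ _ c (fun i _ => h4 i)
    simp only [Finset.card_univ, Fintype.card_fin, nsmul_eq_mul] at e2 e3 e4
    rw [hB, hM]; linarith
  refine ⟨by linarith, by linarith, ?_, by linarith, ?_, ?_⟩
  · have e1 : ∑ i, |x i| ≤ (∑ i, √|x i|) * B := by
      rw [Finset.sum_mul]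
      refine Finset.sum_le_sum fun i _ => ?_
      have := mx i
      have h := Real.mul_self_sqrt (abs_nonneg (x i))
      have := mul_le_mul_of_nonneg_left (show √|x i| ≤ B by linarith) (Real.sqrt_nonneg |x i|)
      linarith
    have e2 : ∑ i, |y i| ≤ (∑ i, √|y i|) * B := by
      rw [Finset.sum_mul]
      refine Finset.sum_le_sum fun i _ => ?_
      have := my i
      have h := Real.mul_self_sqrt (abs_nonneg (y i))
      have := mul_le_mul_of_nonneg_left (show √|y i| ≤ B by linarith) (Real.sqrt_nonneg |y i|)
      linarith
    have : ((∑ i, √|x i|) + (∑ i, √|y i|)) * B ≤ B * B :=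
      mul_le_mul_of_nonneg_right (by linarith) hB0
    nlinarith
  · have := gen 1 (Real.sqrt_le_one.2 hε1.le) (fun i => Real.sqrt_le_one.2 (hx i))
      (fun i => Real.sqrt_le_one.2 (hy i)) hw
    linarith
  · have := gen √A (Real.sqrt_le_sqrt (by linarith))
      (fun i => Real.sqrt_le_sqrt (by linarith [lx i]))
      (fun i => Real.sqrt_le_sqrt (by linarith [ly i]))
      (fun i => (hle _ (norm_nonneg _) (hw i)).trans (Real.sqrt_le_sqrt (by linarith [lw i])))
    calc B ^ 2 ≤ (M * √A) ^ 2 := by gcongr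
      _ = _ := by rw [mul_pow, Real.sq_sqrt hA0]

theorem I1_estimate_alpha (n m s : ℕ) (hm : 0 < m) (hmn : m < n) (k h : ℤ)
    (α : ℝ) (hα0 : 0 < α) (hα1 : α < 1)
    (hcase : (2 * (n : ℤ) - 2 * (m : ℤ) ≤ k ∧ k + h - (s : ℤ) ≤ 2 * (n : ℤ) - (m : ℤ) - 1) ∨
      (k ≤ 2 * (n : ℤ) - 2 * (m : ℤ) - 1 ∧ k + 2 * (h - (s : ℤ)) ≤ 2 * (n : ℤ))) :
    ∃ C > (0 : ℝ),
      ∀ ε ∈ Set.Ioo (0 : ℝ) 1, ∀ δ ∈ Set.Ioo (0 : ℝ) 1,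
        (∫ x : (Fin s → ℝ) × (Fin m → ℝ) × (Fin (n - m) → ℂ) in
            {p : (Fin s → ℝ) × (Fin m → ℝ) × (Fin (n - m) → ℂ) |
              (∑ i, |p.1 i|) + (∑ i, |p.2.1 i|) + (∑ i, ‖p.2.2 i‖ ^ 2) < δ ^ 2},
          (ε + (∑ i, |x.1 i|) + (∑ i, |x.2.1 i|) + ∑ i, ‖x.2.2 i‖) ^ (-k) *
            (Real.sqrt ε + (∑ i, Real.sqrt |x.1 i|) + (∑ i, Real.sqrt |x.2.1 i|) +
              ∑ i, ‖x.2.2 i‖) ^ (-(2 * (h : ℝ) - α)))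
        ≤ C * δ ^ α := by
  obtain ⟨N, rfl⟩ : ∃ N, n = m + N := ⟨n - m, by omega⟩
  have hN : 0 < N := by omega
  rw [show m + N - m = N by omega]
  have hmR : (1 : ℝ) ≤ m := by exact_mod_cast hm
  have hNR : (1 : ℝ) ≤ N := by exact_mod_cast hN
  have hsR : (0 : ℝ) ≤ s := by positivity
  obtain ⟨p, q, C, hp, hpT, hq, hqN, hpq, hC, hbound⟩ := pointwise ((s : ℝ) + m) N k h α
    (1 + s + m + N) (by linarith) hNR (by linarith) hα0 hα1
    (by rcases le_or_gt h 0 with h0 | h0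
        · left; exact_mod_cast h0
        · right; exact_mod_cast h0)
    (by rcases lt_or_ge k 0 with h0 | h0
        · left; exact_mod_cast h0
        · right; exact_mod_cast h0)
    (by
      push_cast at hcase
      rcases hcase with ⟨h1, h2⟩ | ⟨h1, h2⟩
      · left
        have h1' : (2 * ((m : ℝ) + N) - 2 * m) ≤ k := by exact_mod_cast h1
        have h2' : (k : ℝ) + h - s ≤ 2 * ((m : ℝ) + N) - m - 1 := by exact_mod_cast h2
        constructor <;> linarith
      · right
        have h1' : (k : ℝ) ≤ (2 * ((m : ℝ) + N) - 2 * m) - 1 := by exact_mod_cast h1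
        have h2' : (k : ℝ) + 2 * (h - s) ≤ 2 * ((m : ℝ) + N) := by exact_mod_cast h2
        constructor <;> linarith)
  set a : ℝ := p / (s + m) with ha
  set b : ℝ := q / N with hb
  have hTpos : (0 : ℝ) < s + m := by linarith
  have ha0 : 0 ≤ a := by positivity
  have hb0 : 0 ≤ b := by positivity
  have hap : (s : ℝ) * a + m * a = p := by rw [ha]; field_simp
  have hbq : (N : ℝ) * b = q := by rw [hb]; field_simp
  have ha1 : a < Module.finrank ℝ ℝ := by
    simp only [Module.finrank_self, Nat.cast_one]
    rw [ha, div_lt_one hTpos]; exact hpT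
  have hb1 : b < Module.finrank ℝ ℂ := by
    rw [Complex.finrank_real_complex, hb, div_lt_iff₀ (by linarith)]; exact_mod_cast hqN
  set I : ℝ := ∫ x : ℝ, phi a 1 x with hI
  set J : ℝ := ∫ x : ℂ, phi b 1 x with hJ
  have hI0 : 0 ≤ I := integral_nonneg fun x => phi_nonneg _ _ _
  have hJ0 : 0 ≤ J := integral_nonneg fun x => phi_nonneg _ _ _
  refine ⟨C * (I ^ s * (I ^ m * J ^ N)) + 1, by positivity, ?_⟩
  intro ε hε δ hδ
  obtain ⟨hδ0, hδ1⟩ := hδ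
  set G : (Fin s → ℝ) × (Fin m → ℝ) × (Fin N → ℂ) → ℝ := fun x =>
    (∏ i, phi a (δ ^ 2) (x.1 i)) * ((∏ i, phi a (δ ^ 2) (x.2.1 i)) * ∏ i, phi b δ (x.2.2 i)) with hG
  have hG0 : ∀ x, 0 ≤ G x := fun x => mul_nonneg (Finset.prod_nonneg fun i _ => phi_nonneg _ _ _)
    (mul_nonneg (Finset.prod_nonneg fun i _ => phi_nonneg _ _ _)
      (Finset.prod_nonneg fun i _ => phi_nonneg _ _ _))
  have hGint : Integrable G := by
    have i1 : ∀ l : ℕ, Integrable (fun x : Fin l → ℝ => ∏ i, phi a (δ ^ 2) (x i)) := fun l =>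
      Integrable.fintype_prod (f := fun _ => phi a (δ ^ 2)) fun i => phi_integrable _ ha1
    have i2 : Integrable (fun x : Fin N → ℂ => ∏ i, phi b δ (x i)) :=
      Integrable.fintype_prod (f := fun _ => phi b δ) fun i => phi_integrable _ hb1
    exact (i1 s).mul_prod ((i1 m).mul_prod i2)
  have hGval : ∫ x, G x = (I ^ s * (I ^ m * J ^ N)) *
      δ ^ (2 * ((s : ℝ) + m) + 2 * N - (2 * p + q)) := by
    have v1 : ∀ l : ℕ, ∫ x : Fin l → ℝ, ∏ i, phi a (δ ^ 2) (x i) =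
        δ ^ (2 * l - 2 * (l * a)) * I ^ l := by
      intro l
      rw [integral_fintype_prod_volume_eq_pow (phi a (δ ^ 2)), phi_integral _ _ (by positivity),
        mul_pow, Fintype.card_fin, ← Real.rpow_natCast (_ ^ _) l, ← Real.rpow_natCast δ 2,
        ← Real.rpow_mul hδ0.le, ← Real.rpow_mul hδ0.le]
      congr 2
      simp; ring
    have v2 : ∫ x : Fin N → ℂ, ∏ i, phi b δ (x i) = δ ^ (2 * N - N * b) * J ^ N := by
      rw [integral_fintype_prod_volume_eq_pow (phi b δ), phi_integral _ _ (by positivity),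
        mul_pow, Fintype.card_fin, ← Real.rpow_natCast (_ ^ _) N,
        ← Real.rpow_mul hδ0.le]
      congr 2
      rw [Complex.finrank_real_complex]; push_cast; ring
    have e1 : ∫ x, G x = (∫ x : Fin s → ℝ, ∏ i, phi a (δ ^ 2) (x i)) *
        ∫ y : (Fin m → ℝ) × (Fin N → ℂ), (∏ i, phi a (δ ^ 2) (y.1 i)) * ∏ i, phi b δ (y.2 i) :=
      integral_prod_mul (fun x : Fin s → ℝ => ∏ i, phi a (δ ^ 2) (x i))
        (fun y : (Fin m → ℝ) × (Fin N → ℂ) => (∏ i, phi a (δ ^ 2) (y.1 i)) * ∏ i, phi b δ (y.2 i))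
    have e2 : ∫ y : (Fin m → ℝ) × (Fin N → ℂ), (∏ i, phi a (δ ^ 2) (y.1 i)) * ∏ i, phi b δ (y.2 i)
        = (∫ x : Fin m → ℝ, ∏ i, phi a (δ ^ 2) (x i)) * ∫ x : Fin N → ℂ, ∏ i, phi b δ (x i) :=
      integral_prod_mul (fun x : Fin m → ℝ => ∏ i, phi a (δ ^ 2) (x i))
        (fun x : Fin N → ℂ => ∏ i, phi b δ (x i))
    rw [e1, e2, v1, v1, v2, show 2 * ((s : ℝ) + m) + 2 * N - (2 * p + q) =
      (2 * s - 2 * (s * a)) + ((2 * m - 2 * (m * a)) + (2 * N - N * b)) by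
        rw [← hap, ← hbq]; ring, Real.rpow_add hδ0, Real.rpow_add hδ0]
    ring
  have hmeas : MeasurableSet {p : (Fin s → ℝ) × (Fin m → ℝ) × (Fin N → ℂ) |
      (∑ i, |p.1 i|) + (∑ i, |p.2.1 i|) + (∑ i, ‖p.2.2 i‖ ^ 2) < δ ^ 2} := by
    refine IsOpen.measurableSet (isOpen_lt ?_ ?_) <;> fun_prop
  have hae : ∀ᵐ x : (Fin s → ℝ) × (Fin m → ℝ) × (Fin N → ℂ),
      (∀ i, x.1 i ≠ 0) ∧ (∀ i, x.2.1 i ≠ 0) ∧ (∀ i, x.2.2 i ≠ 0) := by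
    have q1 := (Measure.quasiMeasurePreserving_fst (μ := (volume : Measure (Fin s → ℝ)))
      (ν := (volume : Measure ((Fin m → ℝ) × (Fin N → ℂ))))).ae (ae_ne (ι := Fin s) (E := ℝ))
    have q2' := (Measure.quasiMeasurePreserving_fst (μ := (volume : Measure (Fin m → ℝ)))
      (ν := (volume : Measure (Fin N → ℂ)))).ae (ae_ne (ι := Fin m) (E := ℝ))
    have q3' := (Measure.quasiMeasurePreserving_snd (μ := (volume : Measure (Fin m → ℝ)))
      (ν := (volume : Measure (Fin N → ℂ)))).ae (ae_ne (ι := Fin N) (E := ℂ))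
    have q2 := (Measure.quasiMeasurePreserving_snd (μ := (volume : Measure (Fin s → ℝ)))
      (ν := (volume : Measure ((Fin m → ℝ) × (Fin N → ℂ))))).ae q2'
    have q3 := (Measure.quasiMeasurePreserving_snd (μ := (volume : Measure (Fin s → ℝ)))
      (ν := (volume : Measure ((Fin m → ℝ) × (Fin N → ℂ))))).ae q3'
    rw [Measure.volume_eq_prod]
    filter_upwards [q1, q2, q3] with x h1 h2 h3 using ⟨h1, h2, h3⟩
  have main : ∀ᵐ x : (Fin s → ℝ) × (Fin m → ℝ) × (Fin N → ℂ),
      (∑ i, |x.1 i|) + (∑ i, |x.2.1 i|) + (∑ i, ‖x.2.2 i‖ ^ 2) < δ ^ 2 →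
      (ε + (∑ i, |x.1 i|) + (∑ i, |x.2.1 i|) + ∑ i, ‖x.2.2 i‖) ^ (-k) *
            (Real.sqrt ε + (∑ i, Real.sqrt |x.1 i|) + (∑ i, Real.sqrt |x.2.1 i|) +
              ∑ i, ‖x.2.2 i‖) ^ (-(2 * (h : ℝ) - α)) ≤ C * G x := by
    filter_upwards [hae] with ⟨x, y, w⟩ ⟨h1, h2, h3⟩ hV
    simp only at h1 h2 h3 hV ⊢
    have sx : 0 ≤ ∑ i, |x i| := Finset.sum_nonneg fun i _ => abs_nonneg _
    have sy : 0 ≤ ∑ i, |y i| := Finset.sum_nonneg fun i _ => abs_nonneg _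
    have sw : 0 ≤ ∑ i, ‖w i‖ ^ 2 := Finset.sum_nonneg fun i _ => by positivity
    have lx : ∀ i, |x i| ≤ ∑ i, |x i| := fun i =>
      Finset.single_le_sum (f := fun i => |x i|) (fun i _ => abs_nonneg _) (Finset.mem_univ i)
    have ly : ∀ i, |y i| ≤ ∑ i, |y i| := fun i =>
      Finset.single_le_sum (f := fun i => |y i|) (fun i _ => abs_nonneg _) (Finset.mem_univ i)
    have lw : ∀ i, ‖w i‖ ≤ ∑ i, ‖w i‖ := fun i =>
      Finset.single_le_sum (f := fun i => ‖w i‖) (fun i _ => norm_nonneg _) (Finset.mem_univ i)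
    have lw2 : ∀ i, ‖w i‖ ^ 2 ≤ ∑ i, ‖w i‖ ^ 2 := fun i =>
      Finset.single_le_sum (f := fun i => ‖w i‖ ^ 2) (fun i _ => by positivity) (Finset.mem_univ i)
    have bx : ∀ i, |x i| < δ ^ 2 := fun i => by linarith [lx i]
    have bY : ∀ i, |y i| < δ ^ 2 := fun i => by linarith [ly i]
    have bw : ∀ i, ‖w i‖ < δ := fun i => by
      have : ‖w i‖ ^ 2 < δ ^ 2 := by linarith [lw2 i]
      exact lt_of_pow_lt_pow_left₀ 2 hδ0.le this
    have hδ2 : δ ^ 2 ≤ 1 := by nlinarith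
    obtain ⟨g1, g2, g3, g4, g5, g6⟩ := geom_s4 N m s ε hε x y w (fun i => by linarith [bx i])
      (fun i => by linarith [bY i]) (fun i => by linarith [bw i]) _ _ _ _ _ rfl rfl rfl rfl rfl
    have hr : 0 < (∑ i, |x i|) + (∑ i, |y i|) := by
      have := ly ⟨0, hm⟩
      have := abs_pos.2 (h2 ⟨0, hm⟩)
      linarith
    have hv : 0 < ∑ i, ‖w i‖ := by
      have := lw ⟨0, hN⟩
      have := norm_pos_iff.2 (h3 ⟨0, hN⟩)
      linarith
    have fin := hbound _ _ _ _ hr hv g1 g2 g3 g4 g5 g6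
    rw [← Int.cast_neg, Real.rpow_intCast] at fin
    refine fin.trans ?_
    refine mul_le_mul_of_nonneg_left ?_ hC.le
    have p1 := prod_bound x h1 (δ ^ 2) a _ ha0 bx (fun i => by
      rw [Real.norm_eq_abs]; linarith [lx i]) hr
    have p2 := prod_bound y h2 (δ ^ 2) a _ ha0 bY (fun i => by
      rw [Real.norm_eq_abs]; linarith [ly i]) hr
    have p3 := prod_bound w h3 δ b _ hb0 bw lw hv
    rw [Fintype.card_fin] at p1 p2 p3
    rw [← hap, ← hbq, neg_add, Real.rpow_add hr, mul_assoc]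
    exact mul_le_mul p1 (mul_le_mul p2 p3 (by positivity)
      (Finset.prod_nonneg fun i _ => phi_nonneg _ _ _)) (by positivity)
      (Finset.prod_nonneg fun i _ => phi_nonneg _ _ _)
  calc _ ≤ ∫ x in {p : (Fin s → ℝ) × (Fin m → ℝ) × (Fin N → ℂ) |
              (∑ i, |p.1 i|) + (∑ i, |p.2.1 i|) + (∑ i, ‖p.2.2 i‖ ^ 2) < δ ^ 2}, C * G x := by
        refine integral_mono_of_nonneg (Filter.Eventually.of_forall fun x => ?_)
          (hGint.const_mul C).integrableOn ((ae_restrict_iff' hmeas).2 main)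
        have := hε.1
        simp only [Pi.zero_apply]
        positivity
    _ ≤ ∫ x, C * G x := setIntegral_le_integral (hGint.const_mul C)
        (Filter.Eventually.of_forall fun x => mul_nonneg hC.le (hG0 x))
    _ = C * (I ^ s * (I ^ m * J ^ N)) * δ ^ (2 * ((s : ℝ) + m) + 2 * N - (2 * p + q)) := by
        rw [integral_const_mul, hGval]; ring
    _ ≤ C * (I ^ s * (I ^ m * J ^ N)) * δ ^ α := by
        have := Real.rpow_le_rpow_of_exponent_ge hδ0 hδ1.le
          (show α ≤ 2 * ((s : ℝ) + m) + 2 * N - (2 * p + q) by linarith)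
        gcongr
    _ ≤ _ := by
        have := Real.rpow_nonneg hδ0.le α
        nlinarith
end

section
/- Let $0<m<n$, $s\ge 0$ integers, $k,h\in\mathbb{Z}$, $0<\alpha<1$, and consider on $\mathbb{R}^s\times\mathbb{R}^m\times\mathbb{C}^{n-m}$ (coordinates $(\rho,\eta,w)$, Lebesgue measure) the kernel $K\{\alpha,k,h,s\}(\rho,\eta,w,\epsilon)=\big(\epsilon+\sum_{i=1}^s|\rho_i|+\sum_{i=1}^m|\eta_i|+\sum_{i=1}^{n-m}|w_i|\big)^{-k}\big(\sqrt{\epsilon}+\sum_{i=1}^s\sqrt{|\rho_i|}+\sum_{i=1}^m\sqrt{|\eta_i|}+\sum_{i=1}^{n-m}|w_i|\big)^{-(2h-\alpha)}$ and $\mathcal{I}_2\{\alpha,k,h,s\}(\epsilon,\delta)=\int_{\mathbf{B}(1)\setminus\mathbf{V}(\delta)}K\{\alpha,k,h,s\}(\rho,\eta,w,\epsilon)\,d\lambda$. If either ($k\ge 2n-2m$ and $k+h-s\le 2n-m$) or ($k\le 2n-2m-1$ and $k+2(h-s)\le 2n+1$), then there exists $C>0$ such that for all $\epsilon\in(0,1)$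 and all $\delta\in(0,1)$ one has $\mathcal{I}_2\{\alpha,k,h,s\}(\epsilon,\delta)\le C\,\delta^{\alpha-1}$. -/
open MeasureTheory

lemma aux_radial {E : Type*} [NormedAddCommGroup E] [NormedSpace ℝ E] [FiniteDimensional ℝ E]
    [Nontrivial E] [MeasurableSpace E] [BorelSpace E] (μ : Measure E) [μ.IsAddHaarMeasure]
    (c : ℝ) (hc : c < Module.finrank ℝ E) :
    ∃ C : ℝ, 0 ≤ C ∧ ∀ R : ℝ, 0 < R →
      ∫⁻ x, (Metric.closedBall (0 : E) R).indicator (fun x => ‖x‖ₑ ^ (-c)) x ∂μ ≤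
        ENNReal.ofReal (C * R ^ ((Module.finrank ℝ E : ℝ) - c)) := by
  set D := Module.finrank ℝ E with hD
  have hD1 : 1 ≤ D := Module.finrank_pos
  have hpos : 0 < (D : ℝ) - c := by linarith
  refine ⟨D * μ.real (Metric.ball 0 1) / (D - c), by positivity, fun R hR => ?_⟩
  set f : ℝ → ℝ := (Set.Iic R).indicator (fun y => y ^ (-c)) with hf
  have key : Set.EqOn (fun y : ℝ => y ^ (D - 1) • f y)
      ((Set.Iic R).indicator (fun y => y ^ ((D : ℝ) - 1 - c))) (Set.Ioi 0) := by
    intro y hy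
    have hy' : 0 < y := hy
    simp only [hf, Set.indicator, smul_eq_mul]
    split_ifs
    · rw [← Real.rpow_natCast, ← Real.rpow_add hy', Nat.cast_sub hD1]
      norm_num
      ring_nf
    · simp
  have hint0 : IntegrableOn (fun y : ℝ => y ^ ((D : ℝ) - 1 - c)) (Set.Ioc 0 R) := by
    have := (intervalIntegral.intervalIntegrable_rpow' (a := 0) (b := R)
      (r := (D : ℝ) - 1 - c) (by linarith))
    rwa [intervalIntegrable_iff_integrableOn_Ioc_of_le hR.le] at this
  have hint : Integrable (fun x : E => f ‖x‖) μ := by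
    rw [integrable_fun_norm_addHaar, integrableOn_congr_fun key measurableSet_Ioi]
    rw [IntegrableOn, integrable_indicator_iff measurableSet_Iic, IntegrableOn,
      Measure.restrict_restrict measurableSet_Iic, Set.inter_comm, Set.Ioi_inter_Iic]
    exact hint0
  have hval := integral_fun_norm_addHaar μ f
  rw [setIntegral_congr_fun measurableSet_Ioi key,
    setIntegral_indicator measurableSet_Iic, Set.Ioi_inter_Iic,
    ← intervalIntegral.integral_of_le hR.le, integral_rpow (Or.inl (by linarith)),
    Real.zero_rpow (by linarith)] at hval
  have hnn : ∀ x : E, 0 ≤ f ‖x‖ := by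
    intro x
    simp only [hf, Set.indicator]
    split_ifs <;> positivity
  have h2 : ∫⁻ x, (Metric.closedBall (0 : E) R).indicator (fun x => ‖x‖ₑ ^ (-c)) x ∂μ
      = ∫⁻ x, ENNReal.ofReal (f ‖x‖) ∂μ := by
    apply lintegral_congr_ae
    have : ∀ᵐ x ∂μ, x ≠ 0 := by simp [ae_iff]
    filter_upwards [this] with x hx
    simp only [hf, Set.indicator, mem_closedBall_zero_iff, Set.mem_Iic]
    split_ifs
    · rw [← ENNReal.ofReal_rpow_of_pos (norm_pos_iff.2 hx), ofReal_norm]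
    · simp
  rw [h2, ← ofReal_integral_eq_lintegral_ofReal hint (Filter.Eventually.of_forall hnn), hval]
  apply ENNReal.ofReal_le_ofReal
  apply le_of_eq
  simp only [nsmul_eq_mul, smul_eq_mul]
  rw [← hD]
  ring_nf

lemma aux_pi {E : Type*} [MeasureSpace E] [SigmaFinite (volume : Measure E)] (n : ℕ)
    (f : E → ENNReal) (hf : Measurable f) :
    ∫⁻ x : Fin n → E, ∏ i, f (x i) = (∫⁻ x, f x) ^ n := by
  induction n with
  | zero => simp [volume_pi]
  | succ n ih =>
    rw [← ((volume_preserving_piFinSuccAbove (fun _ : Fin (n+1) => E) 0).symm).lintegral_comp_emb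
      (MeasurableEquiv.measurableEmbedding _)]
    simp_rw [MeasurableEquiv.piFinSuccAbove_symm_apply, Fin.insertNthEquiv,
            Fin.prod_univ_succ, Fin.insertNth_zero, Equiv.coe_fn_mk, Fin.cons_succ,
            Fin.cons_zero]
    rw [Measure.volume_eq_prod]
    have := lintegral_prod_mul (μ := (volume : Measure E)) (ν := (volume : Measure (Fin n → E)))
      (f := f) (g := fun x => ∏ i, f (x i)) hf.aemeasurable (Measurable.aemeasurable (by fun_prop))
    erw [this]
    rw [ih, pow_succ, mul_comm]

/-- box integral -/
lemma aux_box (s m N : ℕ) (c e : ℝ) (hc : c < 1) (he : e < 2) :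
    ∃ C : ℝ, 0 ≤ C ∧ ∀ R t : ℝ, 0 < R → 0 < t →
      ∫⁻ x : (Fin s → ℝ) × (Fin m → ℝ) × (Fin N → ℂ),
        (∏ i, (Metric.closedBall (0 : ℝ) R).indicator (fun x => ‖x‖ₑ ^ (-c)) (x.1 i)) *
        ((∏ i, (Metric.closedBall (0 : ℝ) R).indicator (fun x => ‖x‖ₑ ^ (-c)) (x.2.1 i)) *
        (∏ i, (Metric.closedBall (0 : ℂ) t).indicator (fun x => ‖x‖ₑ ^ (-e)) (x.2.2 i))) ≤
      ENNReal.ofReal (C * (R ^ ((s + m : ℝ) * (1 - c)) * t ^ ((N : ℝ) * (2 - e)))) := by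
  obtain ⟨C1, hC1, h1⟩ := aux_radial (volume : Measure ℝ) c (by simpa using hc)
  obtain ⟨C2, hC2, h2⟩ := aux_radial (volume : Measure ℂ) e (by simpa using he)
  refine ⟨C1 ^ s * (C1 ^ m * C2 ^ N), by positivity, fun R t hR ht => ?_⟩
  have m1 : Measurable ((Metric.closedBall (0 : ℝ) R).indicator (fun x => ‖x‖ₑ ^ (-c))) :=
    Measurable.indicator (by fun_prop) Metric.isClosed_closedBall.measurableSet
  have m2 : Measurable ((Metric.closedBall (0 : ℂ) t).indicator (fun x => ‖x‖ₑ ^ (-e))) :=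
    Measurable.indicator (by fun_prop) Metric.isClosed_closedBall.measurableSet
  have h1' := h1 R hR
  have h2' := h2 t ht
  generalize (Metric.closedBall (0 : ℝ) R).indicator (fun x => ‖x‖ₑ ^ (-c)) = g1 at *
  generalize (Metric.closedBall (0 : ℂ) t).indicator (fun x => ‖x‖ₑ ^ (-e)) = g2 at *
  rw [Measure.volume_eq_prod,
    lintegral_prod_mul (f := fun x : Fin s → ℝ => ∏ i, g1 (x i))
      (g := fun x : (Fin m → ℝ) × (Fin N → ℂ) => (∏ i, g1 (x.1 i)) * (∏ i, g2 (x.2 i)))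
      (Measurable.aemeasurable (by fun_prop)) (Measurable.aemeasurable (by fun_prop)),
    Measure.volume_eq_prod,
    lintegral_prod_mul (f := fun x : Fin m → ℝ => ∏ i, g1 (x i))
      (g := fun x : (Fin N → ℂ) => (∏ i, g2 (x i)))
      (Measurable.aemeasurable (by fun_prop)) (Measurable.aemeasurable (by fun_prop)),
    aux_pi _ _ m1, aux_pi _ _ m1, aux_pi _ _ m2]
  refine (mul_le_mul' (pow_le_pow_left' h1' s) (mul_le_mul' (pow_le_pow_left' h1' m)
    (pow_le_pow_left' h2' N))).trans ?_
  simp only [Module.finrank_self, Complex.finrank_real_complex]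
  rw [← ENNReal.ofReal_pow (by positivity), ← ENNReal.ofReal_pow (by positivity),
    ← ENNReal.ofReal_pow (by positivity), ← ENNReal.ofReal_mul (by positivity),
    ← ENNReal.ofReal_mul (by positivity)]
  apply ENNReal.ofReal_le_ofReal
  apply le_of_eq
  rw [mul_pow, mul_pow, mul_pow, ← Real.rpow_mul_natCast hR.le, ← Real.rpow_mul_natCast hR.le,
    ← Real.rpow_mul_natCast ht.le, add_mul, Real.rpow_add hR]
  push_cast
  ring_nf

lemma aux_prod_s5 {E : Type*} [NormedAddCommGroup E] (n : ℕ) (x : Fin n → E) (X c u : ℝ) (hX : 0 < X)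
    (hc : 0 ≤ c) (hu : u = c * n) (hx : ∀ i, ‖x i‖ ≤ X) :
    ENNReal.ofReal (X ^ (-u)) ≤ ∏ i, ‖x i‖ₑ ^ (-c) := by
  have : ENNReal.ofReal (X ^ (-u)) = ∏ i : Fin n, (ENNReal.ofReal X) ^ (-c) := by
    rw [Finset.prod_const, Finset.card_univ, Fintype.card_fin, ← ENNReal.rpow_mul_natCast,
      ENNReal.ofReal_rpow_of_pos hX, hu, neg_mul]
  rw [this]
  apply Finset.prod_le_prod'
  intro i _
  rw [ENNReal.rpow_neg, ENNReal.rpow_neg, ENNReal.inv_le_inv]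
  apply ENNReal.rpow_le_rpow _ hc
  rw [← ofReal_norm]
  exact ENNReal.ofReal_le_ofReal (hx i)

lemma aux_layer (p T : ℝ) (hp : 0 < p) (hT : 0 < T) :
    ENNReal.ofReal (T ^ (-p)) = ∫⁻ t in Set.Ioi T, ENNReal.ofReal (p * t ^ (-p - 1)) := by
  have hi : IntegrableOn (fun t : ℝ => t ^ (-p - 1)) (Set.Ioi T) :=
    integrableOn_Ioi_rpow_of_lt (by linarith) hT
  rw [← ofReal_integral_eq_lintegral_ofReal (hi.const_mul p)]
  · rw [integral_const_mul, integral_Ioi_rpow_of_lt (by linarith) hT]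
    congr 1
    have : -p - 1 + 1 = -p := by ring
    rw [this]
    field_simp
  · filter_upwards [ae_restrict_mem measurableSet_Ioi] with t ht
    have : 0 < t := hT.trans ht
    simp only [Pi.zero_apply]
    positivity

lemma aux_raise (Z M z v : ℝ) (hZ : 0 < Z) (hM : Z ≤ M) (h : z ≤ v) :
    Z ^ (-z) ≤ M ^ (v - z) * Z ^ (-v) := by
  have : Z ^ (-z) = Z ^ (v - z) * Z ^ (-v) := by
    rw [← Real.rpow_add hZ]; ring_nf
  rw [this]
  gcongr

lemma aux_anti (X A u : ℝ) (hX : 0 < X) (h : X ≤ A) (hu : 0 ≤ u) : A ^ (-u) ≤ X ^ (-u) :=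
  Real.rpow_le_rpow_of_nonpos hX h (by linarith)

lemma aux_real1 (N d : ℕ) (hN : 0 < N) (hd : 0 < d) (k h : ℤ) (α : ℝ) (hα0 : 0 < α) (hα1 : α < 1)
    (hk : 2 * (N : ℤ) ≤ k) (hkh : k + h ≤ 2 * (N : ℤ) + d) (M : ℝ) (hM : 1 ≤ M) :
    ∃ C > (0 : ℝ), ∀ A T X Y : ℝ, 0 < X → X ≤ A → 0 < Y → Y ≤ A → A ≤ M → √Y ≤ T →
      T ≤ M * √A →
      A ^ (-k) * T ^ (-(2 * (h : ℝ) - α)) ≤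
        C * (X ^ (-(2 * (N : ℝ) - α / 4)) * Y ^ (-((d : ℝ) - α / 4))) := by
  have hk' : 2 * (N : ℝ) ≤ k := by exact_mod_cast hk
  have hkh' : (k : ℝ) + h ≤ 2 * N + d := by exact_mod_cast hkh
  have hN' : (1 : ℝ) ≤ N := by exact_mod_cast hN
  have hd' : (1 : ℝ) ≤ d := by exact_mod_cast hd
  have hM0 : 0 < M := by linarith
  rcases le_or_gt 1 h with h1 | h1
  · have h1' : (1 : ℝ) ≤ h := by exact_mod_cast h1
    refine ⟨M ^ ((d : ℝ) - α / 4 - (k - (2 * (N : ℝ) - α / 4) + (h - α / 2))), by positivity, ?_⟩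
    intro A T X Y hX hXA hY hYA hAM hYT hTA
    have hA : 0 < A := hX.trans_le hXA
    have e1 : A ^ (-k) = A ^ (-(2 * (N : ℝ) - α / 4)) * A ^ (-(k - (2 * (N : ℝ) - α / 4))) := by
      rw [← Real.rpow_add hA, ← Real.rpow_intCast]
      push_cast; ring_nf
    have e2 : T ^ (-(2 * (h : ℝ) - α)) ≤ Y ^ (-(h - α / 2)) := by
      refine (aux_anti (√Y) T _ (by positivity) hYT (by linarith)).trans (le_of_eq ?_)
      rw [Real.sqrt_eq_rpow, ← Real.rpow_mul hY.le]
      ring_nf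
    have e3 := aux_anti X A (2 * (N : ℝ) - α / 4) hX hXA (by linarith)
    have e4 := aux_anti Y A (k - (2 * (N : ℝ) - α / 4)) hY hYA (by linarith)
    have e5 := aux_raise Y M (k - (2 * (N : ℝ) - α / 4) + (h - α / 2)) (d - α / 4) hY
      (hYA.trans hAM) (by linarith)
    have e6 : Y ^ (-(k - (2 * (N : ℝ) - α / 4))) * Y ^ (-((h : ℝ) - α / 2)) =
        Y ^ (-(k - (2 * (N : ℝ) - α / 4) + (h - α / 2))) := by
      rw [← Real.rpow_add hY]; ring_nf
    have hT : 0 ≤ T := (Real.sqrt_nonneg _).trans hYT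
    calc A ^ (-k) * T ^ (-(2 * (h : ℝ) - α))
        ≤ (X ^ (-(2 * (N : ℝ) - α / 4)) * Y ^ (-(k - (2 * (N : ℝ) - α / 4)))) *
          Y ^ (-((h : ℝ) - α / 2)) := by
          rw [e1]; gcongr
      _ = X ^ (-(2 * (N : ℝ) - α / 4)) * Y ^ (-(k - (2 * (N : ℝ) - α / 4) + (h - α / 2))) := by
          rw [mul_assoc, e6]
      _ ≤ X ^ (-(2 * (N : ℝ) - α / 4)) *
          (M ^ ((d : ℝ) - α / 4 - (k - (2 * (N : ℝ) - α / 4) + (h - α / 2))) *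
            Y ^ (-((d : ℝ) - α / 4))) := by gcongr
      _ = _ := by ring
  · have h1' : (h : ℝ) ≤ 0 := by exact_mod_cast (by omega : h ≤ 0)
    refine ⟨M ^ (-(2 * (h : ℝ) - α)) * M ^ (2 * (N : ℝ) + d - α / 2 - (k + h - α / 2)),
      by positivity, ?_⟩
    intro A T X Y hX hXA hY hYA hAM hYT hTA
    have hA : 0 < A := hX.trans_le hXA
    have hT : 0 < T := (Real.sqrt_pos.2 hY).trans_le hYT
    have e2 : T ^ (-(2 * (h : ℝ) - α)) ≤ M ^ (-(2 * (h : ℝ) - α)) * A ^ (-(h - α / 2)) := by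
      refine (Real.rpow_le_rpow hT.le hTA (by linarith)).trans (le_of_eq ?_)
      rw [Real.mul_rpow hM0.le (by positivity), Real.sqrt_eq_rpow, ← Real.rpow_mul hA.le]
      ring_nf
    have e3 := aux_anti X A (2 * (N : ℝ) - α / 4) hX hXA (by linarith)
    have e4 := aux_anti Y A (d - α / 4) hY hYA (by linarith)
    have e5 := aux_raise A M (k + h - α / 2) (2 * (N : ℝ) + d - α / 2) hA hAM (by linarith)
    have e6 : A ^ (-k) * A ^ (-((h : ℝ) - α / 2)) = A ^ (-(k + h - α / 2)) := by
      rw [← Real.rpow_intCast, ← Real.rpow_add hA]; push_cast; ring_nf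
    have e7 : A ^ (-(2 * (N : ℝ) + d - α / 2)) =
        A ^ (-(2 * (N : ℝ) - α / 4)) * A ^ (-((d : ℝ) - α / 4)) := by
      rw [← Real.rpow_add hA]; ring_nf
    calc A ^ (-k) * T ^ (-(2 * (h : ℝ) - α))
        ≤ A ^ (-k) * (M ^ (-(2 * (h : ℝ) - α)) * A ^ (-(h - α / 2))) := by gcongr
      _ = M ^ (-(2 * (h : ℝ) - α)) * A ^ (-(k + h - α / 2)) := by rw [← e6]; ring
      _ ≤ M ^ (-(2 * (h : ℝ) - α)) * (M ^ (2 * (N : ℝ) + d - α / 2 - (k + h - α / 2)) *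
            A ^ (-(2 * (N : ℝ) + d - α / 2))) := by gcongr
      _ ≤ M ^ (-(2 * (h : ℝ) - α)) * (M ^ (2 * (N : ℝ) + d - α / 2 - (k + h - α / 2)) *
            (X ^ (-(2 * (N : ℝ) - α / 4)) * Y ^ (-((d : ℝ) - α / 4)))) := by
          rw [e7]; gcongr
      _ = _ := by ring

lemma aux_real2 (N d : ℕ) (hN : 0 < N) (k h : ℤ) (α : ℝ) (hα1 : α < 1)
    (hk : k ≤ 2 * (N : ℤ) - 1) (hkh : k + 2 * h ≤ 2 * (N : ℤ) + 2 * d + 1) (M : ℝ) (hM : 1 ≤ M) :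
    ∃ κ : ℝ, 0 ≤ κ ∧ κ < 2 * N ∧ ∃ C > (0 : ℝ), ∀ A T X S : ℝ, 0 < X → X ≤ A → 0 < S → S ≤ T →
      A ≤ T → T ≤ M →
      A ^ (-k) * T ^ (-(2 * (h : ℝ) - α)) ≤
        C * (X ^ (-κ) * S ^ (-(2 * (N : ℝ) + 2 * d - κ + 1 - α))) := by
  have hk' : (k : ℝ) ≤ 2 * N - 1 := by exact_mod_cast hk
  have hkh' : (k : ℝ) + 2 * h ≤ 2 * N + 2 * d + 1 := by exact_mod_cast hkh
  have hN' : (1 : ℝ) ≤ N := by exact_mod_cast hN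
  have hd' : (0 : ℝ) ≤ d := by positivity
  have hM0 : 0 < M := by linarith
  rcases le_or_gt 0 k with h0 | h0
  · have h0' : (0 : ℝ) ≤ k := by exact_mod_cast h0
    refine ⟨k, h0', by linarith, M ^ ((2 * (N : ℝ) + 2 * d - k + 1 - α) - (2 * (h : ℝ) - α)),
      by positivity, ?_⟩
    intro A T X S hX hXA hS hST hAT hTM
    have hA : 0 < A := hX.trans_le hXA
    have hT : 0 < T := hS.trans_le hST
    have e1 : A ^ (-k) ≤ X ^ (-(k : ℝ)) := by
      rw [← Real.rpow_intCast]; push_cast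
      exact aux_anti X A k hX hXA h0'
    have e2 := aux_raise T M (2 * (h : ℝ) - α) (2 * (N : ℝ) + 2 * d - k + 1 - α) hT hTM
      (by linarith)
    have e3 := aux_anti S T (2 * (N : ℝ) + 2 * d - k + 1 - α) hS hST (by linarith)
    calc A ^ (-k) * T ^ (-(2 * (h : ℝ) - α))
        ≤ X ^ (-(k : ℝ)) * (M ^ ((2 * (N : ℝ) + 2 * d - k + 1 - α) - (2 * (h : ℝ) - α)) *
            S ^ (-(2 * (N : ℝ) + 2 * d - k + 1 - α))) := by
          gcongr
          exact e2.trans (by gcongr)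
      _ = _ := by ring
  · have h0' : (k : ℝ) ≤ 0 := by exact_mod_cast h0.le
    refine ⟨0, le_rfl, by linarith,
      M ^ ((2 * (N : ℝ) + 2 * d - 0 + 1 - α) - (k + 2 * (h : ℝ) - α)), by positivity, ?_⟩
    intro A T X S hX hXA hS hST hAT hTM
    have hA : 0 < A := hX.trans_le hXA
    have hT : 0 < T := hS.trans_le hST
    have e1 : A ^ (-k) ≤ T ^ (-(k : ℝ)) := by
      rw [← Real.rpow_intCast]; push_cast
      exact Real.rpow_le_rpow hA.le hAT (by linarith)
    have e2 := aux_raise T M (k + 2 * (h : ℝ) - α) (2 * (N : ℝ) + 2 * d - 0 + 1 - α) hT hTM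
      (by linarith)
    have e3 := aux_anti S T (2 * (N : ℝ) + 2 * d - 0 + 1 - α) hS hST (by linarith)
    have e4 : T ^ (-(k : ℝ)) * T ^ (-(2 * (h : ℝ) - α)) = T ^ (-(k + 2 * (h : ℝ) - α)) := by
      rw [← Real.rpow_add hT]; ring_nf
    rw [neg_zero, Real.rpow_zero, one_mul]
    calc A ^ (-k) * T ^ (-(2 * (h : ℝ) - α))
        ≤ T ^ (-(k : ℝ)) * T ^ (-(2 * (h : ℝ) - α)) := by gcongr
      _ ≤ _ := e4.le.trans (e2.trans (by gcongr))

lemma aux_sum_le_s5 {n : ℕ} (f : Fin n → ℝ) (c : ℝ) (h : ∀ i, f i ≤ c) : ∑ i, f i ≤ n * c := by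
  refine (Finset.sum_le_card_nsmul Finset.univ f c (fun i _ => h i)).trans (le_of_eq ?_)
  simp

lemma aux_coord {n : ℕ} (f : Fin n → ℝ) (h : ∀ i, 0 ≤ f i) (i : Fin n) : f i ≤ ∑ i, f i :=
  Finset.single_le_sum (fun i _ => h i) (Finset.mem_univ i)

lemma aux_case1 (s m N : ℕ) (hm : 0 < m) (hN : 0 < N) (k h : ℤ)
    (α : ℝ) (hα0 : 0 < α) (hα1 : α < 1)
    (hk : 2 * (N : ℤ) ≤ k) (hkh : k + h ≤ 2 * (N : ℤ) + ((s + m : ℕ) : ℤ)) :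
    ∃ C : ℝ, 0 ≤ C ∧ ∀ ε ∈ Set.Ioo (0 : ℝ) 1,
      ∫⁻ x : (Fin s → ℝ) × (Fin m → ℝ) × (Fin N → ℂ) in
        {p : (Fin s → ℝ) × (Fin m → ℝ) × (Fin N → ℂ) |
              (∑ i, p.1 i ^ 2) + (∑ i, p.2.1 i ^ 2) + (∑ i, ‖p.2.2 i‖ ^ 2) < 1},
        ENNReal.ofReal
         ((ε + (∑ i, |x.1 i|) + (∑ i, |x.2.1 i|) + ∑ i, ‖x.2.2 i‖) ^ (-k) *
            (Real.sqrt ε + (∑ i, Real.sqrt |x.1 i|) + (∑ i, Real.sqrt |x.2.1 i|) +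
              ∑ i, ‖x.2.2 i‖) ^ (-(2 * (h : ℝ) - α))) ≤ ENNReal.ofReal C := by
  have hN' : (1 : ℝ) ≤ N := by exact_mod_cast hN
  have hd' : (1 : ℝ) ≤ s + m := by exact_mod_cast (by omega : 1 ≤ s + m)
  set M : ℝ := 1 + s + m + N with hM
  have hM1 : 1 ≤ M := by rw [hM]; linarith
  obtain ⟨C1, hC1, hreal⟩ := aux_real1 N (s + m) hN (by omega) k h α hα0 hα1 hk hkh M hM1
  set c : ℝ := 1 - α / 4 / (s + m) with hc
  set e : ℝ := 2 - α / 4 / N with he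
  have hc1 : α / 4 / (s + m) ≤ 1 / 4 := by
    rw [div_le_iff₀ (by linarith)]; nlinarith
  have he1 : α / 4 / N ≤ 1 / 4 := by
    rw [div_le_iff₀ (by linarith)]; nlinarith
  have hc2 : 0 < α / 4 / (s + m) := by positivity
  have he2 : 0 < α / 4 / N := by positivity
  obtain ⟨C2, hC2, hbox⟩ := aux_box s m N c e (by linarith) (by linarith)
  refine ⟨C1 * C2, by positivity, fun ε hε => ?_⟩
  have hb := hbox 1 1 one_pos one_pos
  simp only [Real.one_rpow, mul_one] at hb
  rw [ENNReal.ofReal_mul hC1.le]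
  refine le_trans ?_ (mul_le_mul' le_rfl hb)
  rw [← lintegral_const_mul' _ _ ENNReal.ofReal_ne_top]
  refine (setLIntegral_mono' ?_ ?_).trans (setLIntegral_le_lintegral _ _)
  · exact measurableSet_lt (by fun_prop) (by fun_prop)
  rintro ⟨ρ, η, w⟩ hx
  simp only [Set.mem_ofPred_eq] at hx ⊢
  have q1 : ∀ i, |ρ i| ≤ 1 := by
    intro i
    have a1 := aux_coord (fun i => ρ i ^ 2) (fun i => sq_nonneg _) i
    have a2 : 0 ≤ ∑ i, η i ^ 2 := Finset.sum_nonneg fun i _ => sq_nonneg _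
    have a3 : 0 ≤ ∑ i, ‖w i‖ ^ 2 := Finset.sum_nonneg fun i _ => sq_nonneg _
    exact (sq_le_one_iff_abs_le_one _).1 (by linarith)
  have q2 : ∀ i, |η i| ≤ 1 := by
    intro i
    have a1 := aux_coord (fun i => η i ^ 2) (fun i => sq_nonneg _) i
    have a2 : 0 ≤ ∑ i, ρ i ^ 2 := Finset.sum_nonneg fun i _ => sq_nonneg _
    have a3 : 0 ≤ ∑ i, ‖w i‖ ^ 2 := Finset.sum_nonneg fun i _ => sq_nonneg _
    exact (sq_le_one_iff_abs_le_one _).1 (by linarith)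
  have q3 : ∀ i, ‖w i‖ ≤ 1 := by
    intro i
    have a1 := aux_coord (fun i => ‖w i‖ ^ 2) (fun i => sq_nonneg _) i
    have a2 : 0 ≤ ∑ i, ρ i ^ 2 := Finset.sum_nonneg fun i _ => sq_nonneg _
    have a3 : 0 ≤ ∑ i, η i ^ 2 := Finset.sum_nonneg fun i _ => sq_nonneg _
    exact (sq_le_one_iff₀ (norm_nonneg _)).1 (by linarith)
  have hε0 := hε.1
  have hε1 := hε.2
  have n1 : 0 ≤ ∑ i, |ρ i| := Finset.sum_nonneg fun i _ => abs_nonneg _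
  have n2 : 0 ≤ ∑ i, |η i| := Finset.sum_nonneg fun i _ => abs_nonneg _
  have n3 : 0 ≤ ∑ i, ‖w i‖ := Finset.sum_nonneg fun i _ => norm_nonneg _
  set A := ε + (∑ i, |ρ i|) + (∑ i, |η i|) + ∑ i, ‖w i‖ with hA
  set T := √ε + (∑ i, √|ρ i|) + (∑ i, √|η i|) + ∑ i, ‖w i‖ with hT
  have p1 : ∀ i, |ρ i| ≤ ∑ i, |ρ i| := aux_coord _ fun i => abs_nonneg _
  have p2 : ∀ i, |η i| ≤ ∑ i, |η i| := aux_coord _ fun i => abs_nonneg _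
  have p3 : ∀ i, ‖w i‖ ≤ ∑ i, ‖w i‖ := aux_coord _ fun i => norm_nonneg _
  have n4 : 0 ≤ ∑ i, √|ρ i| := Finset.sum_nonneg fun i _ => Real.sqrt_nonneg _
  have n5 : 0 ≤ ∑ i, √|η i| := Finset.sum_nonneg fun i _ => Real.sqrt_nonneg _
  have hAM : A ≤ M := by
    have := aux_sum_le_s5 _ _ q1
    have := aux_sum_le_s5 _ _ q2
    have := aux_sum_le_s5 _ _ q3
    linarith
  have hTA : T ≤ M * √A := by
    have b0 : √ε ≤ √A := Real.sqrt_le_sqrt (by linarith)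
    have b1 := aux_sum_le_s5 (fun i => √|ρ i|) (√A)
      fun i => Real.sqrt_le_sqrt (by linarith [p1 i])
    have b2 := aux_sum_le_s5 (fun i => √|η i|) (√A)
      fun i => Real.sqrt_le_sqrt (by linarith [p2 i])
    have b3 := aux_sum_le_s5 (fun i => ‖w i‖) (√A) fun i => by
      apply Real.le_sqrt_of_sq_le
      have := q3 i
      have := p3 i
      have := norm_nonneg (w i)
      nlinarith
    rw [hM]; linarith
  have sq_sum : ∀ (n : ℕ) (f : Fin n → ℝ), (∀ i, 0 ≤ f i) → ∑ i, f i ≤ (∑ i, √(f i)) ^ 2 := by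
    intro n f hf
    calc ∑ i, f i = ∑ i, √(f i) ^ 2 := by
          refine Finset.sum_congr rfl fun i _ => (Real.sq_sqrt (hf i)).symm
      _ ≤ _ := Finset.sum_sq_le_sq_sum_of_nonneg fun i _ => Real.sqrt_nonneg _
  have hYT : √(ε + (∑ i, |ρ i|) + (∑ i, |η i|)) ≤ T := by
    have hs := Real.sqrt_nonneg ε
    apply Real.sqrt_le_iff.2
    refine ⟨by positivity, ?_⟩
    have c1 := sq_sum s (fun i => |ρ i|) fun i => abs_nonneg _
    have c2 := sq_sum m (fun i => |η i|) fun i => abs_nonneg _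
    have c3 := Real.sq_sqrt hε0.le
    rw [hT]
    nlinarith [mul_nonneg hs n4, mul_nonneg hs n5, mul_nonneg hs n3, mul_nonneg n4 n5,
      mul_nonneg n4 n3, mul_nonneg n5 n3, mul_nonneg n3 n3]
  have main := hreal A T (ε + ∑ i, ‖w i‖) (ε + (∑ i, |ρ i|) + (∑ i, |η i|)) (by linarith)
    (by linarith) (by linarith) (by linarith) hAM hYT hTA
  refine (ENNReal.ofReal_le_ofReal main).trans ?_
  rw [ENNReal.ofReal_mul hC1.le]
  gcongr
  have i1 : ∏ i, (Metric.closedBall (0 : ℝ) 1).indicator (fun x => ‖x‖ₑ ^ (-c)) (ρ i)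
      = ∏ i, ‖ρ i‖ₑ ^ (-c) := by
    refine Finset.prod_congr rfl fun i _ => Set.indicator_of_mem ?_ _
    simpa using q1 i
  have i2 : ∏ i, (Metric.closedBall (0 : ℝ) 1).indicator (fun x => ‖x‖ₑ ^ (-c)) (η i)
      = ∏ i, ‖η i‖ₑ ^ (-c) := by
    refine Finset.prod_congr rfl fun i _ => Set.indicator_of_mem ?_ _
    simpa using q2 i
  have i3 : ∏ i, (Metric.closedBall (0 : ℂ) 1).indicator (fun x => ‖x‖ₑ ^ (-e)) (w i)
      = ∏ i, ‖w i‖ₑ ^ (-e) := by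
    refine Finset.prod_congr rfl fun i _ => Set.indicator_of_mem ?_ _
    simpa using q3 i
  rw [i1, i2, i3, ENNReal.ofReal_mul (by positivity)]
  set Y := ε + (∑ i, |ρ i|) + (∑ i, |η i|) with hY
  have hYpos : 0 < Y := by linarith
  have eY : Y ^ (-(((s + m : ℕ) : ℝ) - α / 4)) = Y ^ (-(c * s)) * Y ^ (-(c * m)) := by
    rw [← Real.rpow_add hYpos]
    congr 1
    rw [hc]; push_cast; field_simp; ring
  rw [eY, ENNReal.ofReal_mul (by positivity), mul_comm, mul_assoc]
  gcongr
  · refine aux_prod_s5 s ρ Y c _ hYpos (by linarith) rfl fun i => ?_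
    rw [Real.norm_eq_abs]; linarith [p1 i]
  · refine aux_prod_s5 m η Y c _ hYpos (by linarith) rfl fun i => ?_
    rw [Real.norm_eq_abs]; linarith [p2 i]
  · refine aux_prod_s5 N w _ e _ (by linarith) (by linarith) ?_ fun i => ?_
    · rw [he]; field_simp
    · linarith [p3 i]

lemma aux_case2 (s m N : ℕ) (hm : 0 < m) (hN : 0 < N) (k h : ℤ)
    (α : ℝ) (hα1 : α < 1)
    (hk : k ≤ 2 * (N : ℤ) - 1) (hkh : k + 2 * h ≤ 2 * (N : ℤ) + 2 * ((s + m : ℕ) : ℤ) + 1) :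
    ∃ C : ℝ, 0 ≤ C ∧ ∀ ε ∈ Set.Ioo (0 : ℝ) 1, ∀ δ ∈ Set.Ioo (0 : ℝ) 1,
      ∫⁻ x : (Fin s → ℝ) × (Fin m → ℝ) × (Fin N → ℂ) in
        {p : (Fin s → ℝ) × (Fin m → ℝ) × (Fin N → ℂ) |
              (∑ i, p.1 i ^ 2) + (∑ i, p.2.1 i ^ 2) + (∑ i, ‖p.2.2 i‖ ^ 2) < 1} \
            {p : (Fin s → ℝ) × (Fin m → ℝ) × (Fin N → ℂ) |
              (∑ i, |p.1 i|) + (∑ i, |p.2.1 i|) + (∑ i, ‖p.2.2 i‖ ^ 2) < δ ^ 2},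
        ENNReal.ofReal
         ((ε + (∑ i, |x.1 i|) + (∑ i, |x.2.1 i|) + ∑ i, ‖x.2.2 i‖) ^ (-k) *
            (Real.sqrt ε + (∑ i, Real.sqrt |x.1 i|) + (∑ i, Real.sqrt |x.2.1 i|) +
              ∑ i, ‖x.2.2 i‖) ^ (-(2 * (h : ℝ) - α))) ≤ ENNReal.ofReal (C * δ ^ (α - 1)) := by
  have hN' : (1 : ℝ) ≤ N := by exact_mod_cast hN
  have hd' : (1 : ℝ) ≤ s + m := by exact_mod_cast (by omega : 1 ≤ s + m)
  set M : ℝ := 1 + s + m + N with hM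
  have hM1 : 1 ≤ M := by rw [hM]; linarith
  obtain ⟨κ, hκ0, hκN, C1, hC1, hreal⟩ := aux_real2 N (s + m) hN k h α hα1 hk hkh M hM1
  set p : ℝ := 2 * (N : ℝ) + 2 * ((s + m : ℕ) : ℝ) - κ + 1 - α with hp
  have hp0 : 0 < p := by rw [hp]; push_cast; linarith
  set e : ℝ := κ / N with he
  have he0 : 0 ≤ e := by positivity
  have he2 : e < 2 := by rw [he, div_lt_iff₀ (by linarith)]; linarith
  obtain ⟨C2, hC2, hbox⟩ := aux_box s m N 0 e one_pos he2
  have hα' : 0 < 1 - α := by linarith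
  refine ⟨C1 * (C2 * p / (1 - α)), by positivity, fun ε hε δ hδ => ?_⟩
  have hε0 := hε.1
  have hε1 := hε.2
  have hδ0 := hδ.1
  let T0 : (Fin s → ℝ) × (Fin m → ℝ) × (Fin N → ℂ) → ℝ := fun x =>
    (∑ i, √|x.1 i|) + (∑ i, √|x.2.1 i|) + ∑ i, ‖x.2.2 i‖
  have hT0m : Measurable T0 := by fun_prop
  let G : (Fin s → ℝ) × (Fin m → ℝ) × (Fin N → ℂ) → ENNReal := fun x =>
    ∏ i, ‖x.2.2 i‖ₑ ^ (-e)
  have hGm : Measurable G := by fun_prop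
  let H : (Fin s → ℝ) × (Fin m → ℝ) × (Fin N → ℂ) → ℝ → ENNReal := fun x t =>
    {q : ((Fin s → ℝ) × (Fin m → ℝ) × (Fin N → ℂ)) × ℝ | T0 q.1 < q.2 ∧ δ < q.2}.indicator
      (fun q => G q.1 * ENNReal.ofReal (p * q.2 ^ (-p - 1))) (x, t)
  have hHm : Measurable (Function.uncurry H) := by
    refine Measurable.indicator (by fun_prop) ?_
    exact (measurableSet_lt (hT0m.comp measurable_fst) measurable_snd).inter
      (measurableSet_lt measurable_const measurable_snd)
  -- the integral of the majorant
  have hmaj : ∫⁻ x, ∫⁻ t, H x t ≤ ENNReal.ofReal (C2 * p / (1 - α) * δ ^ (α - 1)) := by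
    rw [lintegral_lintegral_swap hHm.aemeasurable]
    have hl := aux_layer (1 - α) δ hα' hδ0
    have e1 : -(1 - α) = α - 1 := by ring
    rw [e1] at hl
    rw [ENNReal.ofReal_mul (by positivity), hl, ← lintegral_const_mul' _ _ ENNReal.ofReal_ne_top,
      ← lintegral_indicator measurableSet_Ioi]
    refine lintegral_mono fun t => ?_
    by_cases ht : δ < t
    · have ht0 : 0 < t := hδ0.trans ht
      rw [Set.indicator_of_mem (show t ∈ Set.Ioi δ from ht)]
      have hb := hbox (t ^ 2) t (by positivity) ht0
      calc ∫⁻ x, H x t ≤ ∫⁻ x : (Fin s → ℝ) × (Fin m → ℝ) × (Fin N → ℂ),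
            ENNReal.ofReal (p * t ^ (-p - 1)) *
            ((∏ i, (Metric.closedBall (0 : ℝ) (t ^ 2)).indicator
              (fun x => ‖x‖ₑ ^ (-(0 : ℝ))) (x.1 i)) *
            ((∏ i, (Metric.closedBall (0 : ℝ) (t ^ 2)).indicator
              (fun x => ‖x‖ₑ ^ (-(0 : ℝ))) (x.2.1 i)) *
            (∏ i, (Metric.closedBall (0 : ℂ) t).indicator
              (fun x => ‖x‖ₑ ^ (-e)) (x.2.2 i)))) := by
            refine lintegral_mono fun x => ?_
            by_cases hx : T0 x < t
            · have n3 : 0 ≤ ∑ i, ‖x.2.2 i‖ := Finset.sum_nonneg fun i _ => norm_nonneg _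
              have n4 : 0 ≤ ∑ i, √|x.1 i| := Finset.sum_nonneg fun i _ => Real.sqrt_nonneg _
              have n5 : 0 ≤ ∑ i, √|x.2.1 i| := Finset.sum_nonneg fun i _ => Real.sqrt_nonneg _
              have hx' : (∑ i, √|x.1 i|) + (∑ i, √|x.2.1 i|) + ∑ i, ‖x.2.2 i‖ < t := hx
              have i1 : ∏ i, (Metric.closedBall (0 : ℝ) (t ^ 2)).indicator
                  (fun x => ‖x‖ₑ ^ (-(0 : ℝ))) (x.1 i) = 1 := by
                refine Finset.prod_eq_one fun i _ => ?_
                rw [Set.indicator_of_mem]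
                · simp
                · have := aux_coord (fun i => √|x.1 i|) (fun i => Real.sqrt_nonneg _) i
                  rw [mem_closedBall_zero_iff, Real.norm_eq_abs]
                  exact (Real.sqrt_le_left ht0.le).1 (by linarith)
              have i2 : ∏ i, (Metric.closedBall (0 : ℝ) (t ^ 2)).indicator
                  (fun x => ‖x‖ₑ ^ (-(0 : ℝ))) (x.2.1 i) = 1 := by
                refine Finset.prod_eq_one fun i _ => ?_
                rw [Set.indicator_of_mem]
                · simp
                · have := aux_coord (fun i => √|x.2.1 i|) (fun i => Real.sqrt_nonneg _) i
                  rw [mem_closedBall_zero_iff, Real.norm_eq_abs]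
                  exact (Real.sqrt_le_left ht0.le).1 (by linarith)
              have i3 : ∏ i, (Metric.closedBall (0 : ℂ) t).indicator
                  (fun x => ‖x‖ₑ ^ (-e)) (x.2.2 i) = G x := by
                refine Finset.prod_congr rfl fun i _ => Set.indicator_of_mem ?_ _
                have := aux_coord (fun i => ‖x.2.2 i‖) (fun i => norm_nonneg _) i
                rw [mem_closedBall_zero_iff]
                linarith
              rw [i1, i2, i3, one_mul, one_mul]
              refine (Set.indicator_le_self _ _ _).trans (le_of_eq ?_)
              exact mul_comm _ _
            · refine le_trans (le_of_eq ?_) zero_le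
              exact Set.indicator_of_notMem (fun hh => hx hh.1) _
        _ ≤ ENNReal.ofReal (p * t ^ (-p - 1)) *
            ENNReal.ofReal (C2 * ((t ^ 2) ^ ((s + m : ℝ) * (1 - 0)) * t ^ ((N : ℝ) * (2 - e)))) := by
            rw [lintegral_const_mul' _ _ ENNReal.ofReal_ne_top]
            gcongr
        _ = _ := by
            rw [← ENNReal.ofReal_mul (by positivity), ← ENNReal.ofReal_mul (by positivity)]
            congr 1
            have e2 : t ^ (α - 1 - 1) = t ^ (-p - 1) *
                ((t ^ 2) ^ ((s + m : ℝ) * (1 - 0)) * t ^ ((N : ℝ) * (2 - e))) := by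
              rw [← Real.rpow_natCast t 2, ← Real.rpow_mul ht0.le, ← Real.rpow_add ht0,
                ← Real.rpow_add ht0]
              congr 1
              rw [hp, he]; push_cast; field_simp; ring
            rw [e2]
            field_simp
    · rw [Set.indicator_of_notMem (show t ∉ Set.Ioi δ from ht)]
      refine le_of_eq ?_
      rw [lintegral_congr (g := fun _ => 0), lintegral_zero]
      intro x
      exact Set.indicator_of_notMem (fun hh => ht hh.2) _
  rw [mul_assoc, ENNReal.ofReal_mul hC1.le]
  refine le_trans ?_ (mul_le_mul' le_rfl hmaj)
  rw [← lintegral_const_mul' _ _ ENNReal.ofReal_ne_top]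
  refine (setLIntegral_mono' ?_ ?_).trans (setLIntegral_le_lintegral _ _)
  · exact (measurableSet_lt (by fun_prop) (by fun_prop)).diff
      (measurableSet_lt (by fun_prop) (by fun_prop))
  rintro x hx
  have hlay : ENNReal.ofReal (T0 x ^ (-p)) * G x ≤ ∫⁻ t, H x t ∨ T0 x < δ := by
    by_cases hT : T0 x < δ
    · exact Or.inr hT
    · left
      have hT' : δ ≤ T0 x := not_lt.1 hT
      rw [aux_layer p (T0 x) hp0 (hδ0.trans_le hT'), ← lintegral_mul_const _ (by fun_prop),
        ← lintegral_indicator measurableSet_Ioi]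
      refine lintegral_mono fun t => ?_
      by_cases ht : T0 x < t
      · rw [Set.indicator_of_mem (show t ∈ Set.Ioi (T0 x) from ht), mul_comm]
        refine le_of_eq (Eq.symm ?_)
        exact Set.indicator_of_mem (show (x, t) ∈ {q : ((Fin s → ℝ) × (Fin m → ℝ) × (Fin N → ℂ)) × ℝ |
          T0 q.1 < q.2 ∧ δ < q.2} from ⟨ht, hT'.trans_lt ht⟩) _
      · rw [Set.indicator_of_notMem (show t ∉ Set.Ioi (T0 x) from ht)]
        exact zero_le
  obtain ⟨ρ, η, w⟩ := x
  obtain ⟨hx, hx2⟩ := hx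
  simp only [Set.mem_ofPred_eq, not_lt] at hx hx2 ⊢
  have q1 : ∀ i, |ρ i| ≤ 1 := by
    intro i
    have a1 := aux_coord (fun i => ρ i ^ 2) (fun i => sq_nonneg _) i
    have a2 : 0 ≤ ∑ i, η i ^ 2 := Finset.sum_nonneg fun i _ => sq_nonneg _
    have a3 : 0 ≤ ∑ i, ‖w i‖ ^ 2 := Finset.sum_nonneg fun i _ => sq_nonneg _
    exact (sq_le_one_iff_abs_le_one _).1 (by linarith)
  have q2 : ∀ i, |η i| ≤ 1 := by
    intro i
    have a1 := aux_coord (fun i => η i ^ 2) (fun i => sq_nonneg _) i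
    have a2 : 0 ≤ ∑ i, ρ i ^ 2 := Finset.sum_nonneg fun i _ => sq_nonneg _
    have a3 : 0 ≤ ∑ i, ‖w i‖ ^ 2 := Finset.sum_nonneg fun i _ => sq_nonneg _
    exact (sq_le_one_iff_abs_le_one _).1 (by linarith)
  have q3 : ∀ i, ‖w i‖ ≤ 1 := by
    intro i
    have a1 := aux_coord (fun i => ‖w i‖ ^ 2) (fun i => sq_nonneg _) i
    have a2 : 0 ≤ ∑ i, ρ i ^ 2 := Finset.sum_nonneg fun i _ => sq_nonneg _
    have a3 : 0 ≤ ∑ i, η i ^ 2 := Finset.sum_nonneg fun i _ => sq_nonneg _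
    exact (sq_le_one_iff₀ (norm_nonneg _)).1 (by linarith)
  have n1 : 0 ≤ ∑ i, |ρ i| := Finset.sum_nonneg fun i _ => abs_nonneg _
  have n2 : 0 ≤ ∑ i, |η i| := Finset.sum_nonneg fun i _ => abs_nonneg _
  have n3 : 0 ≤ ∑ i, ‖w i‖ := Finset.sum_nonneg fun i _ => norm_nonneg _
  have p3 : ∀ i, ‖w i‖ ≤ ∑ i, ‖w i‖ := aux_coord _ fun i => norm_nonneg _
  have n4 : 0 ≤ ∑ i, √|ρ i| := Finset.sum_nonneg fun i _ => Real.sqrt_nonneg _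
  have n5 : 0 ≤ ∑ i, √|η i| := Finset.sum_nonneg fun i _ => Real.sqrt_nonneg _
  have sq_sum : ∀ (n : ℕ) (f : Fin n → ℝ), (∀ i, 0 ≤ f i) → ∑ i, f i ≤ (∑ i, √(f i)) ^ 2 := by
    intro n f hf
    calc ∑ i, f i = ∑ i, √(f i) ^ 2 := by
          refine Finset.sum_congr rfl fun i _ => (Real.sq_sqrt (hf i)).symm
      _ ≤ _ := Finset.sum_sq_le_sq_sum_of_nonneg fun i _ => Real.sqrt_nonneg _
  have hTdef : T0 (ρ, η, w) = (∑ i, √|ρ i|) + (∑ i, √|η i|) + ∑ i, ‖w i‖ := rfl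
  have hTδ : δ ≤ T0 (ρ, η, w) := by
    have c1 := sq_sum s (fun i => |ρ i|) fun i => abs_nonneg _
    have c2 := sq_sum m (fun i => |η i|) fun i => abs_nonneg _
    have c3 : ∑ i, ‖w i‖ ^ 2 ≤ (∑ i, ‖w i‖) ^ 2 :=
      Finset.sum_sq_le_sq_sum_of_nonneg fun i _ => norm_nonneg _
    rw [hTdef]
    refine le_of_sq_le_sq ?_ (by positivity)
    nlinarith [mul_nonneg n4 n5, mul_nonneg n4 n3, mul_nonneg n5 n3]
  have hlay' := hlay.resolve_right (not_lt.2 hTδ)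
  have le_sqrt_self : ∀ y : ℝ, 0 ≤ y → y ≤ 1 → y ≤ √y := by
    intro y h0 h1
    apply Real.le_sqrt_of_sq_le
    nlinarith
  have r1 : ∑ i, |ρ i| ≤ ∑ i, √|ρ i| :=
    Finset.sum_le_sum fun i _ => le_sqrt_self _ (abs_nonneg _) (q1 i)
  have r2 : ∑ i, |η i| ≤ ∑ i, √|η i| :=
    Finset.sum_le_sum fun i _ => le_sqrt_self _ (abs_nonneg _) (q2 i)
  have r0 := le_sqrt_self ε hε0.le hε1.le
  have hTM : √ε + (∑ i, √|ρ i|) + (∑ i, √|η i|) + ∑ i, ‖w i‖ ≤ M := by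
    have b0 : √ε ≤ 1 := Real.sqrt_le_one.2 hε1.le
    have b1 := aux_sum_le_s5 (fun i => √|ρ i|) 1 fun i => Real.sqrt_le_one.2 (q1 i)
    have b2 := aux_sum_le_s5 (fun i => √|η i|) 1 fun i => Real.sqrt_le_one.2 (q2 i)
    have b3 := aux_sum_le_s5 _ _ q3
    rw [hM]; linarith
  have main := hreal (ε + (∑ i, |ρ i|) + (∑ i, |η i|) + ∑ i, ‖w i‖)
    (√ε + (∑ i, √|ρ i|) + (∑ i, √|η i|) + ∑ i, ‖w i‖) (ε + ∑ i, ‖w i‖) (T0 (ρ, η, w))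
    (by linarith) (by linarith) (by linarith) (by rw [hTdef]; linarith) (by linarith) hTM
  refine (ENNReal.ofReal_le_ofReal main).trans ?_
  rw [ENNReal.ofReal_mul hC1.le]
  gcongr
  refine le_trans ?_ hlay'
  rw [ENNReal.ofReal_mul (by positivity), mul_comm]
  gcongr
  refine aux_prod_s5 N w _ e _ (by linarith) he0 ?_ fun i => ?_
  · rw [he]; field_simp
  · linarith [p3 i]



/-- Lemma (Integral estimates), case `𝓘₂{α,k,h,s}` with `0 < α < 1`: under either
(`k ≥ 2n-2m` and `k+h-s ≤ 2n-m`) or (`k ≤ 2n-2m-1` and `k+2(h-s) ≤ 2n+1`), the integral of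
`K{α,k,h,s}` over `B(1) \ V(δ)` is `O(δ^(α-1))`. -/
theorem I2_estimate_alpha_sub_one (n m s : ℕ) (hm : 0 < m) (hmn : m < n) (k h : ℤ)
    (α : ℝ) (hα0 : 0 < α) (hα1 : α < 1)
    (hcase : (2 * (n : ℤ) - 2 * (m : ℤ) ≤ k ∧ k + h - (s : ℤ) ≤ 2 * (n : ℤ) - (m : ℤ)) ∨
      (k ≤ 2 * (n : ℤ) - 2 * (m : ℤ) - 1 ∧ k + 2 * (h - (s : ℤ)) ≤ 2 * (n : ℤ) + 1)) :
    ∃ C > (0 : ℝ),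
      ∀ ε ∈ Set.Ioo (0 : ℝ) 1, ∀ δ ∈ Set.Ioo (0 : ℝ) 1,
        (∫ x : (Fin s → ℝ) × (Fin m → ℝ) × (Fin (n - m) → ℂ) in
            {p : (Fin s → ℝ) × (Fin m → ℝ) × (Fin (n - m) → ℂ) |
              (∑ i, p.1 i ^ 2) + (∑ i, p.2.1 i ^ 2) + (∑ i, ‖p.2.2 i‖ ^ 2) < 1} \
            {p : (Fin s → ℝ) × (Fin m → ℝ) × (Fin (n - m) → ℂ) |
              (∑ i, |p.1 i|) + (∑ i, |p.2.1 i|) + (∑ i, ‖p.2.2 i‖ ^ 2) < δ ^ 2},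
          (ε + (∑ i, |x.1 i|) + (∑ i, |x.2.1 i|) + ∑ i, ‖x.2.2 i‖) ^ (-k) *
            (Real.sqrt ε + (∑ i, Real.sqrt |x.1 i|) + (∑ i, Real.sqrt |x.2.1 i|) +
              ∑ i, ‖x.2.2 i‖) ^ (-(2 * (h : ℝ) - α)))
        ≤ C * δ ^ (α - 1) := by
  obtain ⟨N, rfl⟩ : ∃ N, n = m + N := ⟨n - m, by omega⟩
  have hsub : m + N - m = N := by omega
  have hN : 0 < N := by omega
  have hnorm : ∀ ε ∈ Set.Ioo (0 : ℝ) 1,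
      ∀ x : (Fin s → ℝ) × (Fin m → ℝ) × (Fin (m + N - m) → ℂ),
      ‖(ε + (∑ i, |x.1 i|) + (∑ i, |x.2.1 i|) + ∑ i, ‖x.2.2 i‖) ^ (-k) *
            (Real.sqrt ε + (∑ i, Real.sqrt |x.1 i|) + (∑ i, Real.sqrt |x.2.1 i|) +
              ∑ i, ‖x.2.2 i‖) ^ (-(2 * (h : ℝ) - α))‖ =
      (ε + (∑ i, |x.1 i|) + (∑ i, |x.2.1 i|) + ∑ i, ‖x.2.2 i‖) ^ (-k) *
            (Real.sqrt ε + (∑ i, Real.sqrt |x.1 i|) + (∑ i, Real.sqrt |x.2.1 i|) +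
              ∑ i, ‖x.2.2 i‖) ^ (-(2 * (h : ℝ) - α)) := by
    intro ε hε x
    have := hε.1
    exact Real.norm_of_nonneg (by positivity)
  have hN' : 0 < m + N - m := by omega
  rcases hcase with ⟨h1, h2⟩ | ⟨h1, h2⟩
  · obtain ⟨C, hC, hb⟩ := aux_case1 s m (m + N - m) hm hN' k h α hα0 hα1
      (by push_cast at *; omega) (by push_cast at *; omega)
    refine ⟨C + 1, by positivity, fun ε hε δ hδ => ?_⟩
    have hδ1 : 1 ≤ δ ^ (α - 1) :=
      Real.one_le_rpow_of_pos_of_le_one_of_nonpos hδ.1 hδ.2.le (by linarith)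
    refine (Real.le_norm_self _).trans ((norm_integral_le_lintegral_norm _).trans ?_)
    simp only [hnorm ε hε]
    refine ENNReal.toReal_le_of_le_ofReal (by positivity) ?_
    refine (lintegral_mono_set Set.sdiff_subset).trans ((hb ε hε).trans ?_)
    exact ENNReal.ofReal_le_ofReal (by nlinarith)
  · obtain ⟨C, hC, hb⟩ := aux_case2 s m (m + N - m) hm hN' k h α hα1
      (by push_cast at *; omega) (by push_cast at *; omega)
    refine ⟨C + 1, by positivity, fun ε hε δ hδ => ?_⟩
    have hδ1 : 1 ≤ δ ^ (α - 1) :=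
      Real.one_le_rpow_of_pos_of_le_one_of_nonpos hδ.1 hδ.2.le (by linarith)
    refine (Real.le_norm_self _).trans ((norm_integral_le_lintegral_norm _).trans ?_)
    simp only [hnorm ε hε]
    refine ENNReal.toReal_le_of_le_ofReal (by positivity) ?_
    refine (hb ε hε δ hδ).trans ?_
    exact ENNReal.ofReal_le_ofReal (by nlinarith)
end
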